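/- arXiv:1911.00647 — 2 statements merged into one kernel-verified Lean document; each statement's English description precedes it below -/
import Mathlib

section
/- For every α > 0, every nilpotent subgroup of the group of orientation-preserving C^{1+α} diffeomorphisms of ℝ admits an invariant Radon measure on ℝ. -/
open Set MeasureTheory
open scoped NNReal

/-- Orientation-preserving homeomorphisms of ℝ, modelled as order-isomorphisms of ℝ
(every order-isomorphism of ℝ is a strictly increasing homeomorphism and conversely). -/
abbrev HomeoR := ℝ ≃o ℝ

/-- The fixed point set of `f`. -/
def FixSet (f : HomeoR) : Set ℝ := {x : ℝ | f x = x}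

/-- `f` and `g` are crossed with `f` in the distinguished role: there is an interval
`(a,b)` with endpoints possibly `±∞` such that `Fix(f) ∩ [a,b] = {a,b}` while `g`
maps `a` or `b` into `(a,b)`. -/
def CrossedAt (f g : HomeoR) : Prop :=
  ∃ a b : EReal, a < b ∧
    ({x : ℝ | a ≤ (x : EReal) ∧ (x : EReal) ≤ b} ∩ FixSet f
      = {x : ℝ | (x : EReal) = a ∨ (x : EReal) = b}) ∧
    (∃ x : ℝ, ((x : EReal) = a ∨ (x : EReal) = b) ∧
      a < (g x : EReal) ∧ (g x : EReal) < b)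

/-- Two elements are crossed. -/
def Crossed (f g : HomeoR) : Prop := CrossedAt f g ∨ CrossedAt g f

/-- `μ` is a (nonzero) `G`-invariant Radon measure on ℝ. -/
def InvariantRadon (G : Subgroup HomeoR) (μ : Measure ℝ) : Prop :=
  μ ≠ 0 ∧ IsFiniteMeasureOnCompacts μ ∧ ∀ g ∈ G, Measure.map (⇑g) μ = μ

/-- `Λ` is a nonempty minimal closed `G`-invariant subset of ℝ. -/
def MinimalSet (G : Subgroup HomeoR) (Λ : Set ℝ) : Prop :=
  Λ.Nonempty ∧ IsClosed Λ ∧ (∀ g ∈ G, ⇑g '' Λ = Λ) ∧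
    ∀ Λ' ⊆ Λ, Λ'.Nonempty → IsClosed Λ' → (∀ g ∈ G, ⇑g '' Λ' = Λ') → Λ' = Λ

theorem not_bddAbove_of_no_fixed {Γ : Type*} [Group Γ] (ρ : Γ →* HomeoR) (H : Subgroup Γ)
    (hH : ∀ x, ∃ h ∈ H, ρ h x ≠ x) {S : Set ℝ} (hne : S.Nonempty)
    (hS : ∀ h ∈ H, ∀ x ∈ S, ρ h x ∈ S) : ¬ BddAbove S := by
  intro hb
  have key : ∀ h ∈ H, ρ h (sSup S) ≤ sSup S := by
    intro h hh
    have : sSup S ≤ ρ h⁻¹ (sSup S) := by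
      refine csSup_le hne fun x hx => ?_
      have h1 : ρ h x ≤ sSup S := le_csSup hb (hS h hh x hx)
      have h2 := (ρ h⁻¹).monotone h1
      simpa using h2
    have h2 := (ρ h).monotone this
    simpa using h2
  obtain ⟨h, hh, hx⟩ := hH (sSup S)
  refine hx (le_antisymm (key h hh) ?_)
  have h2 := (ρ h).monotone (key h⁻¹ (H.inv_mem hh))
  simpa using h2

theorem not_bddBelow_of_no_fixed {Γ : Type*} [Group Γ] (ρ : Γ →* HomeoR) (H : Subgroup Γ)
    (hH : ∀ x, ∃ h ∈ H, ρ h x ≠ x) {S : Set ℝ} (hne : S.Nonempty)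
    (hS : ∀ h ∈ H, ∀ x ∈ S, ρ h x ∈ S) : ¬ BddBelow S := by
  intro hb
  have key : ∀ h ∈ H, sInf S ≤ ρ h (sInf S) := by
    intro h hh
    have : ρ h⁻¹ (sInf S) ≤ sInf S := by
      refine le_csInf hne fun x hx => ?_
      have h1 : sInf S ≤ ρ h x := csInf_le hb (hS h hh x hx)
      have h2 := (ρ h⁻¹).monotone h1
      simpa using h2
    have h2 := (ρ h).monotone this
    simpa using h2
  obtain ⟨h, hh, hx⟩ := hH (sInf S)
  refine hx (le_antisymm ?_ (key h hh))
  have h2 := (ρ h).monotone (key h⁻¹ (H.inv_mem hh))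
  simpa using h2

/-- A homomorphism to `ℝ` that is monotone along an orbit yields an invariant measure. -/
theorem exists_invariantRadon_of_hom {Γ : Type*} [Group Γ] (ρ : Γ →* HomeoR) (τ : Γ → ℝ)
    (hmul : ∀ h k, τ (h * k) = τ h + τ k) (p : ℝ) (hmono : ∀ h, ρ h p ≤ p → τ h ≤ 0)
    (hup : ∀ x, ∃ h, x < ρ h p) (hdown : ∀ x, ∃ h, ρ h p < x) (hτ : ∃ g, τ g ≠ 0) :
    ∃ μ : Measure ℝ, μ ≠ 0 ∧ IsFiniteMeasureOnCompacts μ ∧ ∀ g, Measure.map (ρ g) μ = μ := by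
  have hone : τ 1 = 0 := by simpa using hmul 1 1
  have hinv : ∀ h, τ h⁻¹ = - τ h := fun h => by
    have := hmul h h⁻¹
    rw [mul_inv_cancel, hone] at this
    linarith
  have hle : ∀ h k, ρ h p ≤ ρ k p → τ h ≤ τ k := by
    intro h k hk
    have : τ (k⁻¹ * h) ≤ 0 := by
      apply hmono
      have := (ρ k⁻¹).monotone hk
      simpa using this
    rw [hmul, hinv] at this
    linarith
  let T : ℝ → Set ℝ := fun x => τ '' {h | x < ρ h p}
  have hTne : ∀ x, (T x).Nonempty := fun x => Set.Nonempty.image τ (hup x)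
  have hTbdd : ∀ x, BddBelow (T x) := by
    intro x
    obtain ⟨k, hk⟩ := hdown x
    refine ⟨τ k, ?_⟩
    rintro _ ⟨h, hh, rfl⟩
    exact hle k h (hk.trans hh).le
  have hmonoF : Monotone fun x => sInf (T x) := by
    intro x y hxy
    refine csInf_le_csInf (hTbdd x) (hTne y) ?_
    rintro _ ⟨h, hh, rfl⟩
    exact ⟨h, lt_of_le_of_lt hxy hh, rfl⟩
  let F : StieltjesFunction ℝ :=
    { toFun := fun x => sInf (T x)
      mono' := hmonoF
      right_continuous' := by
        intro x
        refine tendsto_order.2 ⟨fun s hs => ?_, fun s hs => ?_⟩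
        · filter_upwards [self_mem_nhdsWithin] with y hy
          exact lt_of_lt_of_le hs (hmonoF hy)
        · obtain ⟨_, ⟨h, hh, rfl⟩, hlt⟩ := exists_lt_of_csInf_lt (hTne x) hs
          filter_upwards [mem_nhdsWithin_of_mem_nhds (Iio_mem_nhds hh)] with y hy
          exact lt_of_le_of_lt (csInf_le (hTbdd y) ⟨h, hy, rfl⟩) hlt }
  have hFle : ∀ g x, F (ρ g x) ≤ F x + τ g := by
    intro g x
    rw [← sub_le_iff_le_add]
    refine le_csInf (hTne x) ?_
    rintro _ ⟨h, hh, rfl⟩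
    rw [sub_le_iff_le_add]
    refine csInf_le (hTbdd _) ⟨g * h, ?_, by rw [hmul, add_comm]⟩
    simpa using hh
  have hF : ∀ g x, F (ρ g x) = F x + τ g := by
    intro g x
    refine le_antisymm (hFle g x) ?_
    have := hFle g⁻¹ (ρ g x)
    rw [hinv] at this
    simp only [map_inv, RelIso.inv_apply_self] at this
    linarith
  refine ⟨F.measure, ?_, inferInstance, ?_⟩
  · intro h0
    obtain ⟨g, hg⟩ := hτ
    have h1 : ∀ a b, F b - F a ≤ 0 := by
      intro a b
      have := F.measure_Ioc a b
      rw [h0] at this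
      simpa using this.symm
    have h2 := h1 p (ρ g p)
    have h3 := h1 (ρ g p) p
    rw [hF] at h2 h3
    apply hg
    linarith
  · intro g
    symm
    refine Measure.ext_of_Ioc _ _ fun a b hab => ?_
    rw [Measure.map_apply (ρ g).continuous.measurable measurableSet_Ioc]
    have : ρ g ⁻¹' Ioc a b = Ioc (ρ g⁻¹ a) (ρ g⁻¹ b) := by
      rw [map_inv]
      exact OrderIso.preimage_Ioc (ρ g) a b
    rw [this, F.measure_Ioc, F.measure_Ioc, hF, hF]
    congr 1
    ring

theorem eq_zero_of_forall_nat_mul_abs_le {x C : ℝ} (h : ∀ n : ℕ, n * |x| ≤ C) : x = 0 := by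
  by_contra hx
  obtain ⟨n, hn⟩ := exists_nat_gt (C / |x|)
  have := h n
  rw [div_lt_iff₀ (abs_pos.2 hx)] at hn
  linarith

theorem exists_homogenization {Γ : Type*} [Group Γ] (φ : Γ → ℝ) (D : ℝ)
    (hφ : ∀ h k, |φ (h * k) - φ h - φ k| ≤ D) :
    ∃ τ : Γ → ℝ, (∀ h, |τ h - φ h| ≤ D) ∧ ∀ h (n : ℕ), τ (h ^ n) = n * τ h := by
  have hD : 0 ≤ D := (abs_nonneg _).trans (hφ 1 1)
  have hpow : ∀ h (n : ℕ), |φ (h ^ (n + 1)) - (n + 1 : ℕ) * φ h| ≤ n * D := by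
    intro h n
    induction n with
    | zero => simp
    | succ n ih =>
      have h1 := hφ (h ^ (n + 1)) h
      rw [← pow_succ] at h1
      rw [abs_le] at *
      push_cast at *
      constructor <;> linarith [ih.1, ih.2, h1.1, h1.2]
  have hsub : ∀ h, Subadditive fun n => φ (h ^ n) + D := by
    intro h m n
    have := (abs_le.1 (hφ (h ^ m) (h ^ n))).2
    rw [← pow_add] at this
    linarith
  have hlim : ∀ h, ∃ L, Filter.Tendsto (fun n : ℕ => φ (h ^ n) / n) Filter.atTop (nhds L) := by
    intro h
    have hb : BddBelow (range fun n : ℕ => (φ (h ^ n) + D) / n) := by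
      refine ⟨min 0 (φ h - D), ?_⟩
      rintro _ ⟨n, rfl⟩
      rcases n with _ | n
      · simp
      · refine (min_le_right _ _).trans ?_
        have h1 := (abs_le.1 (hpow h n)).1
        have : (0 : ℝ) < (n + 1 : ℕ) := by positivity
        simp only
        rw [le_div_iff₀ this]
        push_cast at *
        nlinarith
    refine ⟨(hsub h).lim - 0, ?_⟩
    have h1 := ((hsub h).tendsto_lim hb).sub (tendsto_const_div_atTop_nhds_zero_nat D)
    refine h1.congr fun n => ?_
    ring
  choose τ hτ using hlim
  refine ⟨τ, fun h => ?_, fun h n => ?_⟩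
  · have h1 : Filter.Tendsto (fun n : ℕ => |φ (h ^ n) / n - φ h|) Filter.atTop
        (nhds |τ h - φ h|) := ((hτ h).sub_const _).abs
    refine le_of_tendsto h1 ?_
    filter_upwards [Filter.eventually_ge_atTop 1] with n hn
    obtain ⟨m, rfl⟩ : ∃ m, n = m + 1 := ⟨n - 1, by omega⟩
    have h2 := hpow h m
    have h3 : (0 : ℝ) < (m + 1 : ℕ) := by positivity
    have h4 : φ (h ^ (m + 1)) / (m + 1 : ℕ) - φ h
        = (φ (h ^ (m + 1)) - (m + 1 : ℕ) * φ h) / (m + 1 : ℕ) := by field_simp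
    rw [h4, abs_div, abs_of_pos h3, div_le_iff₀ h3]
    refine h2.trans ?_
    push_cast
    nlinarith
  · rcases Nat.eq_zero_or_pos n with rfl | hn
    · have h1 := hτ (h ^ 0)
      simp only [pow_zero, one_pow] at h1 ⊢
      have h2 := tendsto_nhds_unique h1 (tendsto_const_div_atTop_nhds_zero_nat _)
      simpa using h2
    · have h1 : Filter.Tendsto (fun k : ℕ => (n : ℝ) * (φ (h ^ (n * k)) / (n * k : ℕ)))
          Filter.atTop (nhds (n * τ h)) :=
        ((hτ h).comp (Filter.tendsto_id.const_mul_atTop' hn)).const_mul _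
      refine tendsto_nhds_unique (hτ (h ^ n)) (h1.congr fun k => ?_)
      rw [← pow_mul]
      have : (n : ℝ) ≠ 0 := by positivity
      push_cast
      field_simp

open scoped commutatorElement in
theorem map_mul_of_homogeneous_of_isNilpotent {Γ : Type*} [Group Γ] [Group.IsNilpotent Γ]
    (τ : Γ → ℝ) (D : ℝ) (hq : ∀ h k, |τ (h * k) - τ h - τ k| ≤ D)
    (hpow : ∀ h (n : ℕ), τ (h ^ n) = n * τ h) (h k : Γ) : τ (h * k) = τ h + τ k := by
  have hone : τ 1 = 0 := by simpa using hpow 1 0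
  have hconj : ∀ k h, τ (k * h * k⁻¹) = τ h := by
    intro k h
    rw [← sub_eq_zero]
    refine eq_zero_of_forall_nat_mul_abs_le (C := 2 * D + |τ k + τ k⁻¹|) fun n => ?_
    have h1 := hq (k * h ^ n) k⁻¹
    have h2 := hq k (h ^ n)
    rw [← conj_pow, hpow] at h1
    rw [hpow] at h2
    have h3 : (n : ℝ) * |τ (k * h * k⁻¹) - τ h| = |n * τ (k * h * k⁻¹) - n * τ h| := by
      rw [← mul_sub, abs_mul, abs_of_nonneg (Nat.cast_nonneg (α := ℝ) n)]
    rw [h3, abs_le]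
    have h4 := abs_le.1 (le_refl |τ k + τ k⁻¹|)
    rw [abs_le] at h1 h2
    constructor <;> linarith
  have key : ∀ j, ∀ z ∈ Subgroup.upperCentralSeries Γ j, ∀ x, τ (x * z) = τ x + τ z := by
    intro j
    induction j with
    | zero =>
      intro z hz x
      rw [Subgroup.upperCentralSeries_zero, Subgroup.mem_bot] at hz
      simp [hz, hone]
    | succ j ih =>
      intro z hz x
      let N : Subgroup Γ :=
        { carrier := {w | w ∈ Subgroup.upperCentralSeries Γ j ∧ τ w = 0}
          mul_mem' := fun {a b} ha hb => ⟨mul_mem ha.1 hb.1, by rw [ih b hb.1, ha.2, hb.2, add_zero]⟩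
          one_mem' := ⟨one_mem _, hone⟩
          inv_mem' := fun {a} ha => ⟨inv_mem ha.1, by
            have := ih a ha.1 a⁻¹
            rw [inv_mul_cancel, hone, ha.2] at this
            linarith⟩ }
      have hN : N.Normal :=
        ⟨fun w hw y => ⟨Subgroup.Normal.conj_mem inferInstance w hw.1 y, by rw [hconj, hw.2]⟩⟩
      have hzx : ⁅z, x⁆ ∈ N := by
        have h1 := Subgroup.mem_upperCentralSeries_succ_iff.1 hz x
        refine ⟨h1, ?_⟩
        have h2 : z * x * z⁻¹ = x * (x⁻¹ * ⁅z, x⁆ * x⁻¹⁻¹) := by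
          rw [commutatorElement_def]; group
        have h3 := hconj z x
        rw [h2, ih _ (Subgroup.Normal.conj_mem inferInstance _ h1 _), hconj] at h3
        linarith
      have hc : Commute (x : Γ ⧸ N) (z : Γ ⧸ N) := by
        have h1 : ((⁅z, x⁆ : Γ) : Γ ⧸ N) = 1 := (QuotientGroup.eq_one_iff _).2 hzx
        have h2 : ⁅(z : Γ ⧸ N), (x : Γ ⧸ N)⁆ = 1 := h1
        exact (commutatorElement_eq_one_iff_commute.1 h2).symm
      rw [← sub_eq_zero, ← sub_sub]
      refine eq_zero_of_forall_nat_mul_abs_le (C := D) fun n => ?_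
      have h1 : ((x ^ n * z ^ n : Γ) : Γ ⧸ N) = (((x * z) ^ n : Γ) : Γ ⧸ N) := by
        exact (hc.mul_pow n).symm
      have h2 := QuotientGroup.eq.1 h1
      have h3 := ih _ h2.1 (x ^ n * z ^ n)
      rw [mul_inv_cancel_left, h2.2, hpow, add_zero] at h3
      have h4 := hq (x ^ n) (z ^ n)
      rw [← h3, hpow, hpow] at h4
      rw [← abs_of_nonneg (Nat.cast_nonneg (α := ℝ) n), ← abs_mul, mul_sub, mul_sub]
      exact h4
  obtain ⟨n, hn⟩ := Group.IsNilpotent.nilpotent Γ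
  exact key n k (hn ▸ Subgroup.mem_top k) h

/-- If some element translates an orbit and commutes with the whole group along that orbit, then
a nilpotent group has an invariant measure. -/
theorem exists_invariantRadon_of_translation {Γ : Type*} [Group Γ] [Group.IsNilpotent Γ]
    (ρ : Γ →* HomeoR) (p : ℝ) (g : Γ) (hgp : p < ρ g p)
    (hup : ∀ x, ∃ m : ℤ, x < ρ (g ^ m) p) (hdown : ∀ x, ∃ m : ℤ, ρ (g ^ m) p < x)
    (hcomm : ∀ (m : ℤ) h, ρ (g ^ m) (ρ h p) = ρ h (ρ (g ^ m) p)) :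
    ∃ μ : Measure ℝ, μ ≠ 0 ∧ IsFiniteMeasureOnCompacts μ ∧ ∀ g, Measure.map (ρ g) μ = μ := by
  have hmono : StrictMono fun m : ℤ => ρ (g ^ m) p := by
    refine strictMono_int_of_lt_succ fun m => ?_
    rw [zpow_add_one, map_mul, RelIso.mul_apply]
    exact (ρ (g ^ m)).strictMono hgp
  have hn : ∀ h, ∃ m : ℤ, ρ (g ^ m) p ≤ ρ h p ∧ ρ h p < ρ (g ^ (m + 1)) p := by
    intro h
    obtain ⟨a, ha⟩ := hup (ρ h p)
    obtain ⟨b, hb⟩ := hdown (ρ h p)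
    obtain ⟨m, hm, hm'⟩ := Int.exists_greatest_of_bdd (P := fun m => ρ (g ^ m) p ≤ ρ h p)
      ⟨a, fun z hz => (hmono.lt_iff_lt.1 (lt_of_le_of_lt hz ha)).le⟩ ⟨b, hb.le⟩
    refine ⟨m, hm, ?_⟩
    by_contra hlt
    have := hm' _ (not_lt.1 hlt)
    omega
  choose n hn1 hn2 using hn
  have hn3 : ∀ h (m : ℤ), ρ (g ^ m) p ≤ ρ h p → m ≤ n h := fun h m hm => by
    have := hmono.lt_iff_lt.1 (lt_of_le_of_lt hm (hn2 h))
    omega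
  have hn4 : ∀ h (m : ℤ), ρ h p < ρ (g ^ m) p → n h < m := fun h m hm =>
    hmono.lt_iff_lt.1 (lt_of_le_of_lt (hn1 h) hm)
  have hq : ∀ h k, |(n (h * k) : ℝ) - n h - n k| ≤ 1 := by
    intro h k
    have h1 : n k + n h ≤ n (h * k) := by
      apply hn3
      rw [zpow_add, map_mul, map_mul, RelIso.mul_apply, RelIso.mul_apply]
      calc _ ≤ ρ (g ^ n k) (ρ h p) := (ρ _).monotone (hn1 h)
        _ = ρ h (ρ (g ^ n k) p) := hcomm _ _
        _ ≤ _ := (ρ h).monotone (hn1 k)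
    have h2 : n (h * k) < (n k + 1) + (n h + 1) := by
      apply hn4
      rw [zpow_add, map_mul, map_mul, RelIso.mul_apply, RelIso.mul_apply]
      calc _ < ρ h (ρ (g ^ (n k + 1)) p) := (ρ h).strictMono (hn2 k)
        _ = ρ (g ^ (n k + 1)) (ρ h p) := (hcomm _ _).symm
        _ < _ := (ρ _).strictMono (hn2 h)
    have h3 : n (h * k) ≤ n k + n h + 1 := by omega
    have h1' : (n k + n h : ℝ) ≤ n (h * k) := by exact_mod_cast h1
    have h3' : (n (h * k) : ℝ) ≤ n k + n h + 1 := by exact_mod_cast h3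
    rw [abs_le]
    constructor <;> linarith
  obtain ⟨τ, hτ1, hτ2⟩ := exists_homogenization (fun h => (n h : ℝ)) 1 hq
  have hτq : ∀ h k, |τ (h * k) - τ h - τ k| ≤ 4 := by
    intro h k
    have h1 := abs_le.1 (hτ1 (h * k))
    have h2 := abs_le.1 (hτ1 h)
    have h3 := abs_le.1 (hτ1 k)
    have h4 := abs_le.1 (hq h k)
    rw [abs_le]
    constructor <;> linarith
  refine exists_invariantRadon_of_hom ρ τ (map_mul_of_homogeneous_of_isNilpotent τ 4 hτq hτ2) p
    ?_ (fun x => (hup x).imp' (g ^ ·) fun _ h => h) (fun x => (hdown x).imp' (g ^ ·) fun _ h => h)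
    ⟨g, ?_⟩
  · intro h hh
    have hk : ∀ k : ℕ, ρ (h ^ k) p ≤ p := by
      intro k
      induction k with
      | zero => simp
      | succ k ih =>
        rw [pow_succ, map_mul, RelIso.mul_apply]
        exact ((ρ _).monotone hh).trans ih
    by_contra hpos
    rw [not_le] at hpos
    obtain ⟨k, hk2⟩ := exists_nat_gt (2 / τ h)
    rw [div_lt_iff₀ hpos, ← hτ2] at hk2
    have h1 := abs_le.1 (hτ1 (h ^ k))
    have h2 : n (h ^ k) < 1 := by
      apply hn4
      rw [zpow_one]
      exact (hk k).trans_lt hgp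
    have h3 : (n (h ^ k) : ℝ) ≤ 0 := by exact_mod_cast Int.lt_add_one_iff.1 h2
    linarith
  · intro h0
    have h1 := abs_le.1 (hτ1 (g ^ 2))
    rw [hτ2, h0] at h1
    have h2 : 2 ≤ n (g ^ 2) := hn3 _ _ (by norm_cast)
    have h3 : (2 : ℝ) ≤ n (g ^ 2) := by exact_mod_cast h2
    linarith

theorem add_single_mem_piAntidiag {s : Finset ℕ} {t i : ℕ} {v : ℕ → ℕ} (hv : v ∈ s.piAntidiag t)
    (hi : i ∈ s) : v + Pi.single i 1 ∈ s.piAntidiag (t + 1) := by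
  rw [Finset.mem_piAntidiag] at hv ⊢
  refine ⟨?_, fun j hj => ?_⟩
  · simp [Finset.sum_add_distrib, hv.1, hi]
  · by_cases hji : j = i
    · rwa [hji]
    · exact hv.2 j (by simpa [Pi.single_apply, hji] using hj)

theorem sub_single_add_single {v : ℕ → ℕ} {i : ℕ} (h : v i ≠ 0) :
    v - Pi.single i 1 + Pi.single i 1 = v := by
  ext j
  by_cases hji : j = i
  · subst hji; simp; omega
  · simp [hji]

theorem sub_single_mem_piAntidiag {s : Finset ℕ} {t i : ℕ} {v : ℕ → ℕ}
    (hv : v ∈ s.piAntidiag (t + 1)) (hi : v i ≠ 0) : v - Pi.single i 1 ∈ s.piAntidiag t := by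
  rw [Finset.mem_piAntidiag] at hv ⊢
  refine ⟨?_, fun j hj => hv.2 j fun h => hj (by simp [h])⟩
  have h1 := hv.1
  rw [← sub_single_add_single hi, Finset.sum_congr rfl fun j _ => Pi.add_apply _ _ j,
    Finset.sum_add_distrib, Finset.sum_pi_single', if_pos (hv.2 i hi)] at h1
  exact Nat.add_right_cancel h1

theorem sum_piAntidiag_succ (d t : ℕ) (φ : (ℕ → ℕ) → ℝ) :
    ∑ v ∈ (Finset.range d).piAntidiag (t + 1), ∑ i ∈ Finset.range d, (v i : ℝ) * φ (v - Pi.single i 1)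
      = (t + d) * ∑ u ∈ (Finset.range d).piAntidiag t, φ u := by
  have key : ∀ i ∈ Finset.range d,
      ∑ v ∈ (Finset.range d).piAntidiag (t + 1), (v i : ℝ) * φ (v - Pi.single i 1)
        = ∑ u ∈ (Finset.range d).piAntidiag t, ((u i : ℝ) + 1) * φ u := by
    intro i hi
    symm
    refine Finset.sum_of_injOn (fun u => u + Pi.single i 1) (fun u _ v _ h => by simpa using h)
      ?_ ?_ ?_
    · exact fun u hu => add_single_mem_piAntidiag hu hi
    · intro v hv hv'
      have : v i = 0 := by
        by_contra h0
        exact hv' ⟨v - Pi.single i 1, sub_single_mem_piAntidiag hv h0, sub_single_add_single h0⟩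
      simp [this]
    · intro u _
      simp
  rw [Finset.sum_comm, Finset.sum_congr rfl key, Finset.sum_comm, Finset.mul_sum]
  refine Finset.sum_congr rfl fun u hu => ?_
  rw [← Finset.sum_mul, Finset.sum_add_distrib, ← Nat.cast_sum, (Finset.mem_piAntidiag.1 hu).1]
  simp

theorem card_piAntidiag_range_succ (p t : ℕ) :
    ((Finset.range (p + 1)).piAntidiag t).card = (t + p).choose p := by
  rw [← Nat.choose_symm_add]
  induction t with
  | zero => simp
  | succ t ih =>
    have h1 := sum_piAntidiag_succ (p + 1) t fun _ => 1
    have h2 : ∑ v ∈ (Finset.range (p + 1)).piAntidiag (t + 1),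
        ∑ i ∈ Finset.range (p + 1), (v i : ℝ) * 1
        = (((Finset.range (p + 1)).piAntidiag (t + 1)).card * (t + 1) : ℕ) := by
      simp only [mul_one, ← Nat.cast_sum]
      rw [Finset.sum_congr rfl fun v hv => (Finset.mem_piAntidiag.1 hv).1]
      simp
    rw [h2, Finset.sum_const, nsmul_eq_mul, mul_one, ih] at h1
    have h3 := Nat.add_one_mul_choose_eq (t + p) t
    have h4 : ((Finset.range (p + 1)).piAntidiag (t + 1)).card * (t + 1)
        = (t + (p + 1)) * (t + p).choose t := by exact_mod_cast h1
    rw [← add_assoc, h3] at h4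
    rw [show t + 1 + p = t + p + 1 by ring]
    exact Nat.eq_of_mul_eq_mul_right t.succ_pos h4

/-- Averaging over all monotone lattice paths: if a step in direction `i` from `v` costs at most
`w v`, then some `v` on the `t`-th level is reached at a cost of at most the sum of the averages
of `w` over the previous levels. -/
theorem exists_lattice_path_le_sum_averages (d : ℕ) (hd : 0 < d) (w : (ℕ → ℕ) → ℝ)
    (P : (ℕ → ℕ) → ℝ → Prop) (hmono : ∀ v m m', m ≤ m' → P v m → P v m') (hzero : P 0 0)
    (hstep : ∀ v, ∀ i < d, ∀ m, P v m → P (v + Pi.single i 1) (w v + m)) (t : ℕ) :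
    ∃ v ∈ (Finset.range d).piAntidiag t, P v (∑ s ∈ Finset.range t,
      (∑ u ∈ (Finset.range d).piAntidiag s, w u) / ((Finset.range d).piAntidiag s).card) := by
  obtain ⟨p, rfl⟩ : ∃ p, d = p + 1 := ⟨d - 1, by omega⟩
  have hN : ∀ t, (0 : ℝ) < ((Finset.range (p + 1)).piAntidiag t).card := fun t => by
    rw [card_piAntidiag_range_succ]
    exact_mod_cast Nat.choose_pos (by omega)
  have hrec : ∀ t : ℕ, ((t : ℝ) + 1) * ((Finset.range (p + 1)).piAntidiag (t + 1)).card
      = (t + (p + 1 : ℕ)) * ((Finset.range (p + 1)).piAntidiag t).card := fun t => by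
    have h1 := sum_piAntidiag_succ (p + 1) t fun _ => 1
    rw [Finset.sum_const, nsmul_eq_mul, mul_one] at h1
    rw [← h1]
    simp only [mul_one, ← Nat.cast_sum]
    rw [Finset.sum_congr rfl fun v hv => (Finset.mem_piAntidiag.1 hv).1]
    simp
    ring
  have key : ∃ m : (ℕ → ℕ) → ℝ, (∀ v ∈ (Finset.range (p + 1)).piAntidiag t, P v (m v)) ∧
      ∑ v ∈ (Finset.range (p + 1)).piAntidiag t, m v
        = ((Finset.range (p + 1)).piAntidiag t).card * ∑ s ∈ Finset.range t,
          (∑ u ∈ (Finset.range (p + 1)).piAntidiag s, w u)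
            / ((Finset.range (p + 1)).piAntidiag s).card := by
    induction t with
    | zero => exact ⟨fun _ => 0, by simpa using hzero, by simp⟩
    | succ t ih =>
      obtain ⟨m, hm1, hm2⟩ := ih
      refine ⟨fun v => (∑ i ∈ Finset.range (p + 1),
        (v i : ℝ) * (w (v - Pi.single i 1) + m (v - Pi.single i 1))) / (t + 1), ?_, ?_⟩
      · intro v hv
        obtain ⟨hv1, hv2⟩ := Finset.mem_piAntidiag.1 hv
        set A := (∑ i ∈ Finset.range (p + 1),
          (v i : ℝ) * (w (v - Pi.single i 1) + m (v - Pi.single i 1))) / (t + 1) with hA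
        have ht : (0 : ℝ) < t + 1 := by positivity
        have hsum : ∑ i ∈ Finset.range (p + 1), (v i : ℝ) * A
            = ∑ i ∈ Finset.range (p + 1),
              (v i : ℝ) * (w (v - Pi.single i 1) + m (v - Pi.single i 1)) := by
          rw [← Finset.sum_mul, ← Nat.cast_sum, hv1, hA]
          push_cast
          field_simp
        obtain ⟨i, hi, hvi, hle⟩ : ∃ i ∈ Finset.range (p + 1), v i ≠ 0 ∧
            w (v - Pi.single i 1) + m (v - Pi.single i 1) ≤ A := by
          by_contra! hcon
          obtain ⟨j, hj, hj0⟩ := Finset.exists_ne_zero_of_sum_ne_zero (by rw [hv1]; omega :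
            ∑ i ∈ Finset.range (p + 1), v i ≠ 0)
          refine absurd hsum (Finset.sum_lt_sum (fun i hi => ?_) ⟨j, hj, ?_⟩).ne
          · rcases eq_or_ne (v i) 0 with h0 | h0
            · simp [h0]
            · exact mul_le_mul_of_nonneg_left (hcon i hi h0).le (Nat.cast_nonneg _)
          · exact mul_lt_mul_of_pos_left (hcon j hj hj0) (by positivity)
        have := hstep _ i (Finset.mem_range.1 hi) _ (hm1 _ (sub_single_mem_piAntidiag hv hvi))
        rw [sub_single_add_single hvi] at this
        exact hmono _ _ _ hle this
      · rw [← Finset.sum_div, sum_piAntidiag_succ (p + 1) t fun u => w u + m u,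
          Finset.sum_add_distrib, hm2, Finset.sum_range_succ]
        have h1 := hrec t
        have h2 := (hN t).ne'
        have h3 := (hN (t + 1)).ne'
        have ht : (t : ℝ) + 1 ≠ 0 := by positivity
        rw [div_eq_iff ht, mul_comm (Nat.cast _ : ℝ) (_ + _), mul_assoc _ (Nat.cast _ : ℝ),
          mul_comm (Nat.cast _ : ℝ) (_ + 1), h1]
        field_simp
        ring
  obtain ⟨m, hm1, hm2⟩ := key
  obtain ⟨v, hv, hle⟩ := Finset.exists_le_of_sum_le
    (Finset.card_pos.1 (by exact_mod_cast hN t))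
    (le_of_eq (hm2.trans (by rw [Finset.sum_const, nsmul_eq_mul])))
  exact ⟨v, hv, hmono _ _ _ hle (hm1 v hv)⟩

theorem sum_rpow_div_card_le {ι : Type*} (s : Finset ι) (hs : s.Nonempty) {α : ℝ} (hα0 : 0 < α)
    (hα1 : α ≤ 1) (l : ι → ℝ) (hl : ∀ v ∈ s, 0 ≤ l v) :
    (∑ v ∈ s, l v ^ α) / s.card ≤ (1 / s.card : ℝ) ^ α * ((∑ v ∈ s, l v) + 1) := by
  have hN : (0 : ℝ) < s.card := by exact_mod_cast Finset.card_pos.2 hs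
  set r : ℝ := 1 / s.card with hr
  have hr0 : 0 < r := by positivity
  have h1 : ∀ v ∈ s, l v ^ α ≤ r ^ α * (s.card * l v + 1) := by
    intro v hv
    have h0 := hl v hv
    have hp : 0 ≤ r ^ α := by positivity
    rcases le_total (l v) r with h | h
    · have := Real.rpow_le_rpow h0 h hα0.le
      have : 0 ≤ r ^ α * (s.card * l v) := by positivity
      linarith
    · have hlv : 0 < l v := hr0.trans_le h
      have h2 : l v ^ α = l v ^ (α - 1) * l v := by
        rw [Real.rpow_sub_one hlv.ne']; field_simp
      have h3 : l v ^ (α - 1) ≤ r ^ (α - 1) :=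
        Real.rpow_le_rpow_of_nonpos hr0 h (by linarith)
      have h4 : r ^ (α - 1) = r ^ α * s.card := by
        rw [Real.rpow_sub_one hr0.ne', hr]; field_simp
      have := mul_le_mul_of_nonneg_right h3 h0
      rw [h2]
      rw [h4] at this
      nlinarith
  rw [div_le_iff₀ hN]
  refine (Finset.sum_le_sum h1).trans (le_of_eq ?_)
  rw [← Finset.mul_sum, Finset.sum_add_distrib, ← Finset.mul_sum]
  simp
  ring

theorem exists_bound_sum_averages (p : ℕ) {α : ℝ} (hα0 : 0 < α) (hα1 : α ≤ 1) (hp : 2 ≤ p * α)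
    (L C : ℝ) (hC : 0 ≤ C) :
    ∃ D : ℝ, ∀ l : (ℕ → ℕ) → ℝ, (∀ v, 0 ≤ l v) →
      (∀ t, ∑ v ∈ (Finset.range (p + 1)).piAntidiag t, l v ≤ L) → ∀ t,
      ∑ s ∈ Finset.range t, (∑ u ∈ (Finset.range (p + 1)).piAntidiag s, C * l u ^ α)
        / ((Finset.range (p + 1)).piAntidiag s).card ≤ D := by
  have hsummable : Summable fun s : ℕ =>
      C * ((p.factorial : ℝ) ^ α * (1 / ((s + 1 : ℕ) : ℝ) ^ 2) * (L + 1)) :=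
    ((((summable_nat_add_iff 1).2 (Real.summable_one_div_nat_pow.2 one_lt_two)).mul_left
      _).mul_right _).mul_left _
  refine ⟨∑' s : ℕ, C * ((p.factorial : ℝ) ^ α * (1 / ((s + 1 : ℕ) : ℝ) ^ 2) * (L + 1)),
    fun l hl hL t => ?_⟩
  have hL0 : 0 ≤ L := (Finset.sum_nonneg fun v _ => hl v).trans (hL 0)
  refine le_trans (Finset.sum_le_sum fun s _ => ?_)
    (hsummable.sum_le_tsum _ fun s _ => by positivity)
  have hcard := card_piAntidiag_range_succ p s
  have hpos : 0 < (s + p).choose p := Nat.choose_pos (by omega)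
  have h1 := sum_rpow_div_card_le ((Finset.range (p + 1)).piAntidiag s)
    (Finset.card_pos.1 (hcard ▸ hpos)) hα0 hα1 l fun v _ => hl v
  rw [← Finset.mul_sum, mul_div_assoc]
  refine mul_le_mul_of_nonneg_left (h1.trans ?_) hC
  refine mul_le_mul ?_ (by linarith [hL s])
    (by have := Finset.sum_nonneg fun v (_ : v ∈ (Finset.range (p + 1)).piAntidiag s) => hl v
        linarith) (by positivity)
  rw [hcard]
  have h2 : (1 : ℝ) / (s + p).choose p ≤ p.factorial * (1 / ((s + 1 : ℕ) : ℝ) ^ p) := by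
    have h3 := Nat.pow_le_choose (α := ℝ) p (s + p)
    rw [show s + p + 1 - p = s + 1 by omega, div_le_iff₀ (by positivity)] at h3
    rw [mul_one_div, div_le_div_iff₀ (by exact_mod_cast hpos) (by positivity)]
    linarith
  refine (Real.rpow_le_rpow (by positivity) h2 hα0.le).trans ?_
  rw [Real.mul_rpow (by positivity) (by positivity)]
  refine mul_le_mul_of_nonneg_left ?_ (by positivity)
  rw [Real.div_rpow zero_le_one (by positivity), Real.one_rpow]
  refine one_div_le_one_div_of_le (by positivity) ?_
  rw [← Real.rpow_natCast, ← Real.rpow_natCast, ← Real.rpow_mul (by positivity)]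
  exact Real.rpow_le_rpow_of_exponent_le (by push_cast; linarith [(Nat.cast_nonneg s : (0:ℝ) ≤ s)])
    (by exact_mod_cast hp)

/-- The product `f (k - 1) ^ v (k - 1) * ⋯ * f 0 ^ v 0`. -/
def powProd {M : Type*} [Monoid M] (f : ℕ → M) (v : ℕ → ℕ) : ℕ → M
  | 0 => 1
  | k + 1 => f k ^ v k * powProd f v k

theorem powProd_congr {M : Type*} [Monoid M] (f : ℕ → M) {v w : ℕ → ℕ} {k : ℕ}
    (h : ∀ i < k, v i = w i) : powProd f v k = powProd f w k := by
  induction k with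
  | zero => rfl
  | succ k ih => rw [powProd, powProd, h k k.lt_succ_self, ih fun i hi => h i (by omega)]

theorem powProd_zero_right {M : Type*} [Monoid M] (f : ℕ → M) (k : ℕ) : powProd f 0 k = 1 := by
  induction k with
  | zero => rfl
  | succ k ih => simp [powProd, ih]

theorem powProd_mem {A : Subgroup HomeoR} {f : ℕ → HomeoR} (hf : ∀ i, f i ∈ A) (v : ℕ → ℕ)
    (k : ℕ) : powProd f v k ∈ A := by
  induction k with
  | zero => exact one_mem A
  | succ k ih => exact mul_mem (pow_mem (hf k) _) ih

theorem apply_powProd_apply {A : Subgroup HomeoR} {K : Set ℝ} (hK : ∀ g ∈ A, ∀ x ∈ K, g x ∈ K)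
    (hcomm : ∀ g ∈ A, ∀ h ∈ A, ∀ x ∈ K, g (h x) = h (g x)) {f : ℕ → HomeoR} (hf : ∀ i, f i ∈ A)
    (v : ℕ → ℕ) {x : ℝ} (hx : x ∈ K) {i k : ℕ} (hik : i < k) :
    f i (powProd f v k x) = powProd f (v + Pi.single i 1) k x := by
  induction k with
  | zero => omega
  | succ k ih =>
    rw [powProd, powProd, RelIso.mul_apply, RelIso.mul_apply]
    rcases Nat.lt_succ_iff_lt_or_eq.1 hik with h | rfl
    · rw [hcomm _ (hf i) _ (pow_mem (hf k) _) _ (hK _ (powProd_mem hf v k) _ hx), ih h]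
      simp [h.ne']
    · rw [← RelIso.mul_apply, ← pow_succ',
        powProd_congr f (v := v + Pi.single i 1) (w := v) (k := i) fun j hj => by simp [hj.ne]]
      simp

theorem pow_apply_eq_of_apply_eq {g : HomeoR} {x : ℝ} (h : g x = x) (n : ℕ) :
    (g ^ n) x = x := by
  induction n with
  | zero => rfl
  | succ n ih => rw [pow_succ, RelIso.mul_apply, h, ih]

theorem inv_apply_eq_of_apply_eq {g : HomeoR} {x : ℝ} (h : g x = x) : g⁻¹ x = x := by
  conv_lhs => rw [← h]
  exact RelIso.inv_apply_self g x

section NestedIntervals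

variable {f : ℕ → HomeoR} {a b : ℕ → ℝ}

theorem powProd_apply_mem_Icc (ha : ∀ k, f k (a (k + 1)) = a (k + 1))
    (hb : ∀ k, f k (b (k + 1)) = b (k + 1)) (ha' : ∀ k, a (k + 1) ≤ a k)
    (hb' : ∀ k, b k ≤ b (k + 1)) (v : ℕ → ℕ) (k : ℕ) :
    a k ≤ powProd f v k (a 0) ∧ powProd f v k (b 0) ≤ b k := by
  induction k with
  | zero => exact ⟨le_rfl, le_rfl⟩
  | succ k ih =>
    rw [powProd, RelIso.mul_apply, RelIso.mul_apply]
    constructor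
    · rw [← pow_apply_eq_of_apply_eq (ha k) (v k)]
      exact (f k ^ v k).monotone ((ha' k).trans ih.1)
    · rw [← pow_apply_eq_of_apply_eq (hb k) (v k)]
      exact (f k ^ v k).monotone (ih.2.trans (hb' k))

theorem powProd_apply_le_of_ne (ha : ∀ k, f k (a (k + 1)) = a (k + 1))
    (hb : ∀ k, f k (b (k + 1)) = b (k + 1)) (ha' : ∀ k, a (k + 1) ≤ a k)
    (hb' : ∀ k, b k ≤ b (k + 1)) (hab : a 0 ≤ b 0) (hf : ∀ k, b k ≤ f k (a k)) (v w : ℕ → ℕ) (k : ℕ)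
    (hvw : ∃ i < k, v i ≠ w i) :
    powProd f v k (b 0) ≤ powProd f w k (a 0) ∨ powProd f w k (b 0) ≤ powProd f v k (a 0) := by
  have habk : ∀ k, a k ≤ b k := by
    intro k
    induction k with
    | zero => exact hab
    | succ k ih => exact (ha' k).trans (ih.trans (hb' k))
  have hmono : ∀ k, Monotone fun n : ℕ => (f k ^ n) (a k) := fun k =>
    monotone_nat_of_le_succ fun n => by
      rw [pow_succ, RelIso.mul_apply]
      exact (f k ^ n).monotone ((habk k).trans (hf k))
  induction k with
  | zero => obtain ⟨i, hi, _⟩ := hvw; omega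
  | succ k ih =>
    have hlt : ∀ v w : ℕ → ℕ, v k < w k →
        powProd f v (k + 1) (b 0) ≤ powProd f w (k + 1) (a 0) := by
      intro v w hk
      rw [powProd, powProd, RelIso.mul_apply, RelIso.mul_apply]
      have h1 := powProd_apply_mem_Icc ha hb ha' hb' v k
      have h2 := powProd_apply_mem_Icc ha hb ha' hb' w k
      calc (f k ^ v k) (powProd f v k (b 0)) ≤ (f k ^ v k) (f k (a k)) :=
            (f k ^ v k).monotone (h1.2.trans (hf k))
        _ = (f k ^ (v k + 1)) (a k) := by rw [pow_succ, RelIso.mul_apply]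
        _ ≤ (f k ^ w k) (a k) := hmono k hk
        _ ≤ _ := (f k ^ w k).monotone h2.1
    rcases lt_trichotomy (v k) (w k) with h | h | h
    · exact Or.inl (hlt v w h)
    · obtain ⟨i, hi, hne⟩ := hvw
      have hik : i < k := by
        rcases Nat.lt_succ_iff_lt_or_eq.1 hi with h' | rfl
        · exact h'
        · exact absurd h hne
      rw [powProd, powProd, h]
      simp only [RelIso.mul_apply]
      exact (ih ⟨i, hik, hne⟩).imp (fun h => (f k ^ w k).monotone h)
        fun h => (f k ^ w k).monotone h
    · exact Or.inr (hlt w v h)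

theorem sum_length_powProd_le (ha : ∀ k, f k (a (k + 1)) = a (k + 1))
    (hb : ∀ k, f k (b (k + 1)) = b (k + 1)) (ha' : ∀ k, a (k + 1) ≤ a k)
    (hb' : ∀ k, b k ≤ b (k + 1)) (hab : a 0 ≤ b 0) (hf : ∀ k, b k ≤ f k (a k)) (d : ℕ)
    (S : Finset (ℕ → ℕ)) (hS : ∀ v ∈ S, ∀ i, v i ≠ 0 → i < d) :
    ∑ v ∈ S, (powProd f v d (b 0) - powProd f v d (a 0)) ≤ b d - a d := by
  have hle : ∀ v, powProd f v d (a 0) ≤ powProd f v d (b 0) := fun v =>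
    (powProd f v d).monotone hab
  have h0 := powProd_apply_mem_Icc ha hb ha' hb' 0 d
  have hd : 0 ≤ b d - a d := by linarith [hle 0]
  rw [← ENNReal.ofReal_le_ofReal_iff hd,
    ENNReal.ofReal_sum_of_nonneg fun v _ => sub_nonneg.2 (hle v)]
  simp only [← Real.volume_Ioo, ← Real.volume_Icc (a := a d)]
  rw [← measure_biUnion_finset _ fun _ _ => measurableSet_Ioo]
  · refine measure_mono (iUnion₂_subset fun v _ => ?_)
    have h := powProd_apply_mem_Icc ha hb ha' hb' v d
    exact (Ioo_subset_Ioo h.1 h.2).trans Ioo_subset_Icc_self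
  · intro v hv w hw hvw
    obtain ⟨i, hi⟩ := Function.ne_iff.1 hvw
    have hid : i < d := by
      by_contra hcon
      have h1 : v i = 0 := by by_contra h; exact hcon (hS v hv i h)
      have h2 : w i = 0 := by by_contra h; exact hcon (hS w hw i h)
      exact hi (h1.trans h2.symm)
    rw [Function.onFun, Set.disjoint_left]
    rintro x ⟨h1, h2⟩ ⟨h3, h4⟩
    rcases powProd_apply_le_of_ne ha hb ha' hb' hab hf v w d ⟨i, hid, hi⟩ with h | h <;> linarith

end NestedIntervals

theorem exists_nested_intervals {A : Subgroup HomeoR}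
    (hA : ∀ x y : ℝ, ∃ g ∈ A, ∃ x' ≤ x, ∃ y' ≥ y, y ≤ g x ∧ g x' = x' ∧ g y' = y') (x y : ℝ) :
    ∃ (f : ℕ → HomeoR) (a b : ℕ → ℝ), (∀ k, f k ∈ A) ∧ a 0 = x ∧ b 0 = y ∧
      (∀ k, f k (a (k + 1)) = a (k + 1)) ∧ (∀ k, f k (b (k + 1)) = b (k + 1)) ∧
      (∀ k, a (k + 1) ≤ a k) ∧ (∀ k, b k ≤ b (k + 1)) ∧ ∀ k, b k ≤ f k (a k) := by
  choose g hg X hX Y hY h1 h2 h3 using hA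
  let s : ℕ → ℝ × ℝ := fun k => Nat.rec (x, y) (fun _ q => (X q.1 q.2, Y q.1 q.2)) k
  exact ⟨fun k => g (s k).1 (s k).2, fun k => (s k).1, fun k => (s k).2, fun k => hg _ _, rfl, rfl,
    fun k => h2 _ _, fun k => h3 _ _, fun k => hX _ _, fun k => hY _ _, fun k => h1 _ _⟩

/-- A `C¹` diffeomorphism of the line whose derivative is locally `α`-Hölder. -/
def IsHolderDiffeo (α : ℝ≥0) (f : HomeoR) : Prop :=
  ContDiff ℝ 1 (⇑f) ∧ (∀ x : ℝ, deriv (⇑f) x ≠ 0) ∧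
    ∀ K : Set ℝ, IsCompact K → ∃ C : ℝ≥0, HolderOnWith C α (deriv (⇑f)) K

theorem IsHolderDiffeo.differentiable {α : ℝ≥0} {f : HomeoR} (hf : IsHolderDiffeo α f) :
    Differentiable ℝ f :=
  hf.1.differentiable one_ne_zero

theorem IsHolderDiffeo.continuous_deriv {α : ℝ≥0} {f : HomeoR} (hf : IsHolderDiffeo α f) :
    Continuous (deriv f) :=
  hf.1.continuous_deriv le_rfl

theorem IsHolderDiffeo.deriv_pos {α : ℝ≥0} {f : HomeoR} (hf : IsHolderDiffeo α f) (x : ℝ) :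
    0 < deriv f x :=
  lt_of_le_of_ne (f.monotone.deriv_nonneg) (hf.2.1 x).symm

theorem IsHolderDiffeo.exists_deriv_le_exp_mul_deriv {α : ℝ≥0} {f : HomeoR}
    (hf : IsHolderDiffeo α f) {β : ℝ} (hβ0 : 0 < β) (hβ : β ≤ α) (u v : ℝ) :
    ∃ C : ℝ, 0 ≤ C ∧ ∀ x ∈ Icc u v, ∀ y ∈ Icc u v,
      deriv f x ≤ Real.exp (C * |x - y| ^ β) * deriv f y := by
  rcases (Icc u v).eq_empty_or_nonempty with he | hne
  · exact ⟨0, le_rfl, by simp [he]⟩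
  obtain ⟨z, hz, hmin⟩ := isCompact_Icc.exists_isMinOn hne hf.continuous_deriv.continuousOn
  obtain ⟨C, hC⟩ := hf.2.2 (Icc u v) isCompact_Icc
  have hm := hf.deriv_pos z
  have huv : 0 ≤ v - u := by
    obtain ⟨q, hq⟩ := hne
    linarith [hq.1, hq.2]
  refine ⟨C * (v - u) ^ (α - β : ℝ) / deriv f z, by positivity, fun x hx y hy => ?_⟩
  have h1 : |deriv f x - deriv f y| ≤ C * |x - y| ^ (α : ℝ) := hC.dist_le hx hy
  have h2 : |x - y| ^ (α : ℝ) ≤ (v - u) ^ (α - β : ℝ) * |x - y| ^ β := by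
    rw [show (α : ℝ) = (α - β) + β by ring,
      Real.rpow_add_of_nonneg (abs_nonneg _) (by linarith) hβ0.le]
    refine mul_le_mul_of_nonneg_right ?_ (by positivity)
    rw [show (α : ℝ) - β + β - β = α - β by ring]
    refine Real.rpow_le_rpow (abs_nonneg _) ?_ (by linarith)
    rw [abs_le]
    constructor <;> linarith [hx.1, hx.2, hy.1, hy.2]
  have h3 : deriv f z ≤ deriv f y := hmin hy
  set E := C * (v - u) ^ (α - β : ℝ) * |x - y| ^ β with hE
  have hE0 : 0 ≤ E := by positivity
  have h4 : deriv f x ≤ deriv f y + E := by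
    have h5 := (abs_le.1 h1).2
    have h6 := mul_le_mul_of_nonneg_left h2 C.coe_nonneg
    rw [← mul_assoc] at h6
    linarith
  have h7 : C * (v - u) ^ (α - β : ℝ) / deriv f z * |x - y| ^ β = E / deriv f z := by
    rw [hE]; ring
  rw [h7]
  have h8 := mul_le_mul_of_nonneg_right (Real.add_one_le_exp (E / deriv f z)) (hm.le.trans h3)
  have h9 : E ≤ E / deriv f z * deriv f y := by
    rw [div_mul_eq_mul_div, le_div_iff₀ hm]
    exact mul_le_mul_of_nonneg_left h3 hE0
  linarith

/-- Under the expansion hypothesis `hexp`, some elements contract `[a, b]` to arbitrarily short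
intervals inside a fixed compact interval, with uniformly bounded distortion. -/
theorem exists_small_image_of_bounded_distortion {α : ℝ≥0} (hα : 0 < α) {A : Subgroup HomeoR}
    (hA : ∀ g ∈ A, IsHolderDiffeo α g) {K : Set ℝ} (hK : ∀ g ∈ A, ∀ x ∈ K, g x ∈ K)
    (hcomm : ∀ g ∈ A, ∀ h ∈ A, ∀ x ∈ K, g (h x) = h (g x))
    (hexp : ∀ x y : ℝ, ∃ g ∈ A, ∃ x' ≤ x, ∃ y' ≥ y, y ≤ g x ∧ g x' = x' ∧ g y' = y')
    {a b : ℝ} (ha : a ∈ K) (hb : b ∈ K) (hab : a < b) :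
    ∃ D u v : ℝ, ∀ ε > 0, ∃ γ ∈ A, u ≤ γ a ∧ γ b ≤ v ∧ γ b - γ a < ε ∧
      ∀ x ∈ Icc a b, ∀ y ∈ Icc a b, deriv γ x ≤ Real.exp D * deriv γ y := by
  obtain ⟨f, s, r, hfA, rfl, rfl, hs, hr, hs', hr', hf⟩ := exists_nested_intervals hexp a b
  set β : ℝ := min α 1 with hβdef
  have hβ0 : 0 < β := lt_min (by exact_mod_cast hα) one_pos
  obtain ⟨p, hp⟩ := exists_nat_ge (2 / β)
  rw [div_le_iff₀ hβ0] at hp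
  set d := p + 1 with hd
  have hCi : ∀ i, ∃ C : ℝ, 0 ≤ C ∧ ∀ x ∈ Icc (s d) (r d), ∀ y ∈ Icc (s d) (r d),
      deriv (f i) x ≤ Real.exp (C * |x - y| ^ β) * deriv (f i) y := fun i =>
    (hA _ (hfA i)).exists_deriv_le_exp_mul_deriv hβ0 (min_le_left _ _) _ _
  choose C hC0 hC using hCi
  set C' := ∑ i ∈ Finset.range d, C i
  have hC'0 : 0 ≤ C' := Finset.sum_nonneg fun i _ => hC0 i
  have hC' : ∀ i < d, C i ≤ C' := fun i hi =>
    Finset.single_le_sum (fun i _ => hC0 i) (Finset.mem_range.2 hi)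
  set l : (ℕ → ℕ) → ℝ := fun v => powProd f v d (r 0) - powProd f v d (s 0) with hl
  have hl0 : ∀ v, 0 ≤ l v := fun v => sub_nonneg.2 ((powProd f v d).monotone hab.le)
  have hsum := sum_length_powProd_le hs hr hs' hr' hab.le hf d
  obtain ⟨D, hD⟩ := exists_bound_sum_averages p hβ0 (min_le_right _ _) hp (r d - s d) C' hC'0
  have hD' := hD l hl0 fun t => hsum _ fun v hv i hi =>
    Finset.mem_range.1 ((Finset.mem_piAntidiag.1 hv).2 i hi)
  set P : (ℕ → ℕ) → ℝ → Prop := fun v m => ∃ γ ∈ A, γ (s 0) = powProd f v d (s 0) ∧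
    γ (r 0) = powProd f v d (r 0) ∧ ∀ x ∈ Icc (s 0) (r 0), ∀ y ∈ Icc (s 0) (r 0),
      deriv γ x ≤ Real.exp m * deriv γ y with hP
  have hmono : ∀ v m m', m ≤ m' → P v m → P v m' := by
    rintro v m m' hm ⟨γ, hγ, h1, h2, h3⟩
    refine ⟨γ, hγ, h1, h2, fun x hx y hy => (h3 x hx y hy).trans ?_⟩
    exact mul_le_mul_of_nonneg_right (Real.exp_le_exp.2 hm) ((hA γ hγ).deriv_pos y).le
  have hzero : P 0 0 := by
    refine ⟨1, one_mem A, by rw [powProd_zero_right], by rw [powProd_zero_right], ?_⟩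
    intro x _ y _
    have : ((1 : HomeoR) : ℝ → ℝ) = id := rfl
    simp [this]
  have hstep : ∀ v, ∀ i < d, ∀ m, P v m → P (v + Pi.single i 1) (C' * l v ^ β + m) := by
    rintro v i hi m ⟨γ, hγ, h1, h2, h3⟩
    refine ⟨f i * γ, mul_mem (hfA i) hγ, ?_, ?_, fun x hx y hy => ?_⟩
    · rw [RelIso.mul_apply, h1, apply_powProd_apply hK hcomm hfA v ha hi]
    · rw [RelIso.mul_apply, h2, apply_powProd_apply hK hcomm hfA v hb hi]
    · have hder : ∀ x, deriv (f i * γ : HomeoR) x = deriv (f i) (γ x) * deriv γ x := fun x =>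
        deriv_comp x (hA _ (hfA i)).differentiable.differentiableAt
          (hA γ hγ).differentiable.differentiableAt
      rw [hder, hder]
      have hbd := powProd_apply_mem_Icc hs hr hs' hr' v d
      have hmem : ∀ x ∈ Icc (s 0) (r 0),
          γ x ∈ Icc (powProd f v d (s 0)) (powProd f v d (r 0)) := fun x hx =>
        ⟨h1 ▸ γ.monotone hx.1, h2 ▸ γ.monotone hx.2⟩
      have hγx := hmem x hx
      have hγy := hmem y hy
      have hsub := Icc_subset_Icc hbd.1 hbd.2
      have h4 := hC i _ (hsub hγx) _ (hsub hγy)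
      have h5 : |γ x - γ y| ≤ l v := by
        rw [abs_le]
        constructor <;> simp only [hl] <;> linarith [hγx.1, hγx.2, hγy.1, hγy.2]
      have h6 : C i * |γ x - γ y| ^ β ≤ C' * l v ^ β :=
        mul_le_mul (hC' i hi) (Real.rpow_le_rpow (abs_nonneg _) h5 hβ0.le) (by positivity) hC'0
      have hp1 := (hA _ (hfA i)).deriv_pos (γ y)
      have h7 := h4.trans (mul_le_mul_of_nonneg_right (Real.exp_le_exp.2 h6) hp1.le)
      refine (mul_le_mul h7 (h3 x hx y hy) ((hA γ hγ).deriv_pos x).le (by positivity)).trans ?_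
      rw [Real.exp_add]
      exact le_of_eq (by ring)
  have hpath := exists_lattice_path_le_sum_averages d (by omega) (fun v => C' * l v ^ β) P hmono
    hzero hstep
  choose w hw hPw using hpath
  refine ⟨D, s d, r d, fun ε hε => ?_⟩
  obtain ⟨n, hn⟩ := exists_nat_gt ((r d - s d) / ε)
  rw [div_lt_iff₀ hε] at hn
  obtain ⟨t, ht⟩ : ∃ t, l (w t) < ε := by
    by_contra! hcon
    have hinj : Function.Injective w := fun t t' h => by
      rw [← (Finset.mem_piAntidiag.1 (hw t)).1, h, (Finset.mem_piAntidiag.1 (hw t')).1]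
    have h1 := hsum ((Finset.range n).map ⟨w, hinj⟩) (by
      intro v hv i hi
      obtain ⟨t, _, rfl⟩ := Finset.mem_map.1 hv
      exact Finset.mem_range.1 ((Finset.mem_piAntidiag.1 (hw t)).2 i hi))
    rw [Finset.sum_map] at h1
    have h2 := Finset.card_nsmul_le_sum (Finset.range n) (fun t => l (w t)) ε fun t _ => hcon t
    rw [Finset.card_range, nsmul_eq_mul] at h2
    exact (h2.trans h1).not_gt hn
  obtain ⟨γ, hγ, h1, h2, h3⟩ := hmono _ _ _ (hD' t) (hPw t)
  have hbd := powProd_apply_mem_Icc hs hr hs' hr' (w t) d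
  exact ⟨γ, hγ, h1 ▸ hbd.1, h2 ▸ hbd.2, by rw [h1, h2]; exact ht, h3⟩

theorem deriv_le_exp_of_commute {α : ℝ≥0} {A : Subgroup HomeoR}
    (hA : ∀ g ∈ A, IsHolderDiffeo α g) {a b D u v : ℝ} (hab : a < b)
    (hγ : ∀ ε > 0, ∃ γ ∈ A, u ≤ γ a ∧ γ b ≤ v ∧ γ b - γ a < ε ∧
      ∀ x ∈ Icc a b, ∀ y ∈ Icc a b, deriv γ x ≤ Real.exp D * deriv γ y)
    {e : HomeoR} (he : IsHolderDiffeo α e) (hcomm : ∀ g ∈ A, ∀ x, e (g x) = g (e x))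
    (hea : e a = a) (heb : e b = b) {x : ℝ} (hx : x ∈ Icc a b) : deriv e x ≤ Real.exp D := by
  refine le_of_forall_pos_le_add fun η hη => ?_
  have huc := (isCompact_Icc (a := u) (b := v)).uniformContinuousOn_of_continuous
    he.continuous_deriv.continuousOn
  obtain ⟨ε, hε, hδ⟩ := Metric.uniformContinuousOn_iff.1 huc (η / Real.exp D) (by positivity)
  obtain ⟨γ, hγA, hγa, hγb, hγε, hdist⟩ := hγ ε hε
  have hlt : γ a < γ b := γ.strictMono hab
  obtain ⟨ξ, hξ, hξ'⟩ := exists_deriv_eq_slope e hlt e.continuous.continuousOn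
    he.differentiable.differentiableOn
  rw [hcomm γ hγA, hcomm γ hγA, hea, heb, div_self (sub_pos.2 hlt).ne'] at hξ'
  have hγx : γ x ∈ Icc (γ a) (γ b) := ⟨γ.monotone hx.1, γ.monotone hx.2⟩
  have hclose := hδ (γ x) (Icc_subset_Icc hγa hγb hγx) ξ
    (Icc_subset_Icc hγa hγb (Ioo_subset_Icc_self hξ)) (by
      rw [Real.dist_eq, abs_lt]
      constructor <;> linarith [hγx.1, hγx.2, hξ.1, hξ.2])
  rw [hξ', Real.dist_eq] at hclose
  have h1 := (abs_lt.1 hclose).2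
  have hγd := (hA γ hγA)
  have hchain : deriv e (γ x) * deriv γ x = deriv γ (e x) * deriv e x := by
    rw [← deriv_comp x he.differentiable.differentiableAt hγd.differentiable.differentiableAt,
      ← deriv_comp x hγd.differentiable.differentiableAt he.differentiable.differentiableAt]
    congr 1
    exact funext (hcomm γ hγA)
  have hex : e x ∈ Icc a b := ⟨hea ▸ e.monotone hx.1, heb ▸ e.monotone hx.2⟩
  have h2 := hdist x hx (e x) hex
  have h3 := hγd.deriv_pos (e x)
  have h4 : deriv γ (e x) * deriv e x
      ≤ (1 + η / Real.exp D) * (Real.exp D * deriv γ (e x)) := by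
    rw [← hchain]
    exact mul_le_mul (by linarith) h2 (hγd.deriv_pos x).le (by positivity)
  have h5 : (1 + η / Real.exp D) * (Real.exp D * deriv γ (e x))
      = deriv γ (e x) * (Real.exp D + η) := by
    field_simp
  rw [h5] at h4
  exact le_of_mul_le_mul_left h4 h3

/-- A generalized Kopell lemma. -/
theorem apply_eq_of_central {α : ℝ≥0} (hα : 0 < α) {G A : Subgroup HomeoR}
    (hG : ∀ g ∈ G, IsHolderDiffeo α g) (hAG : A ≤ G) {K : Set ℝ}
    (hK : ∀ g ∈ A, ∀ x ∈ K, g x ∈ K)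
    (hcomm : ∀ g ∈ A, ∀ h ∈ A, ∀ x ∈ K, g (h x) = h (g x))
    (hexp : ∀ x y : ℝ, ∃ g ∈ A, ∃ x' ≤ x, ∃ y' ≥ y, y ≤ g x ∧ g x' = x' ∧ g y' = y')
    {a b : ℝ} (ha : a ∈ K) (hb : b ∈ K) {c : HomeoR} (hc : c ∈ G)
    (hcA : ∀ g ∈ A, Commute c g) (hca : c a = a) (hcb : c b = b) {x : ℝ} (hx : x ∈ Icc a b) :
    c x = x := by
  rcases (hx.1.trans hx.2).eq_or_lt with rfl | hab
  · rw [← le_antisymm hx.1 hx.2, hca]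
  obtain ⟨D, u, v, hγ⟩ := exists_small_image_of_bounded_distortion hα
    (fun g hg => hG g (hAG hg)) hK hcomm hexp ha hb hab
  have key : ∀ c ∈ G, (∀ g ∈ A, Commute c g) → c a = a → c b = b → ¬ x < c x := by
    intro c hc hcA hca hcb hlt
    have hmem : ∀ n : ℕ, (c ^ n) x ∈ Icc a b := fun n => by
      constructor
      · rw [← pow_apply_eq_of_apply_eq hca n]
        exact (c ^ n).monotone hx.1
      · rw [← pow_apply_eq_of_apply_eq hcb n]
        exact (c ^ n).monotone hx.2
    have hstep : ∀ n : ℕ, c x - x ≤ Real.exp D * ((c ^ (n + 1)) x - (c ^ n) x) := by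
      intro n
      set e : HomeoR := c⁻¹ ^ n with he
      have heG : IsHolderDiffeo α e := hG _ (pow_mem (inv_mem hc) n)
      have hecomm : ∀ g ∈ A, ∀ x, e (g x) = g (e x) := fun g hg x => by
        rw [← RelIso.mul_apply, ← RelIso.mul_apply, (((hcA g hg).inv_left).pow_left n).eq]
      have hde : ∀ y ∈ Icc a b, ‖deriv e y‖ ≤ Real.exp D := fun y hy => by
        rw [Real.norm_of_nonneg (heG.deriv_pos y).le]
        exact deriv_le_exp_of_commute (fun g hg => hG g (hAG hg)) hab hγ heG hecomm
          (pow_apply_eq_of_apply_eq (inv_apply_eq_of_apply_eq hca) n)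
          (pow_apply_eq_of_apply_eq (inv_apply_eq_of_apply_eq hcb) n) hy
      have h1 := (convex_Icc a b).norm_image_sub_le_of_norm_deriv_le
        (fun y _ => heG.differentiable.differentiableAt) hde (hmem n) (hmem (n + 1))
      have h2 : e ((c ^ n) x) = x := by
        rw [he, inv_pow]; exact RelIso.inv_apply_self _ _
      have h3 : e ((c ^ (n + 1)) x) = c x := by
        rw [he, inv_pow, pow_succ, RelIso.mul_apply]; exact RelIso.inv_apply_self _ _
      rw [h2, h3, Real.norm_of_nonneg (sub_nonneg.2 hlt.le), Real.norm_of_nonneg] at h1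
      · exact h1
      · rw [pow_succ, RelIso.mul_apply]
        exact sub_nonneg.2 ((c ^ n).monotone hlt.le)
    obtain ⟨n, hn⟩ := exists_nat_gt (Real.exp D * (b - a) / (c x - x))
    rw [div_lt_iff₀ (sub_pos.2 hlt)] at hn
    have h1 := Finset.card_nsmul_le_sum (Finset.range n)
      (fun n => Real.exp D * ((c ^ (n + 1)) x - (c ^ n) x)) _ fun n _ => hstep n
    rw [Finset.card_range, nsmul_eq_mul, ← Finset.mul_sum,
      Finset.sum_range_sub fun n => (c ^ n) x] at h1
    have h2 := hmem n
    have h3 := hmem 0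
    have h4 : Real.exp D * ((c ^ n) x - (c ^ 0) x) ≤ Real.exp D * (b - a) :=
      mul_le_mul_of_nonneg_left (by linarith [h2.2, h3.1]) (Real.exp_pos D).le
    linarith
  refine le_antisymm (not_lt.1 (key c hc hcA hca hcb)) ?_
  have h1 := not_lt.1 (key c⁻¹ (inv_mem hc) (fun g hg => (hcA g hg).inv_left)
    (inv_apply_eq_of_apply_eq hca)
    (inv_apply_eq_of_apply_eq hcb))
  have h2 := c.monotone h1
  rwa [RelIso.apply_inv_self] at h2

theorem exists_mem_fixed_of_fixed {K : Set ℝ} (hKc : IsClosed K) (hKb : ¬ BddBelow K)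
    {g : HomeoR} (hK : ∀ x ∈ K, g x ∈ K) (hK' : ∀ x ∈ K, g⁻¹ x ∈ K) {p : ℝ} (hp : g p = p) :
    ∃ q ∈ K, g q = q := by
  set S := K ∩ Iic p with hS
  have hSne : S.Nonempty := by
    obtain ⟨y, hy, hyp⟩ := not_bddBelow_iff.1 hKb p
    exact ⟨y, hy, hyp.le⟩
  have hSb : BddAbove S := ⟨p, fun y hy => hy.2⟩
  have hle : ∀ g : HomeoR, (∀ x ∈ K, g⁻¹ x ∈ K) → g p = p → sSup S ≤ g (sSup S) := by
    intro g hK' hp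
    refine csSup_le hSne fun x hx => ?_
    have h1 : g⁻¹ x ≤ p := by
      rw [← g.le_iff_le, RelIso.apply_inv_self, hp]
      exact hx.2
    have h2 := g.monotone (le_csSup hSb ⟨hK' x hx.1, h1⟩)
    rwa [RelIso.apply_inv_self] at h2
  refine ⟨sSup S, ((hKc.inter isClosed_Iic).csSup_mem hSne hSb).1, le_antisymm ?_ (hle g hK' hp)⟩
  have h1 := g.monotone (hle g⁻¹ (by simpa using hK) (inv_apply_eq_of_apply_eq hp))
  rwa [RelIso.apply_inv_self] at h1

theorem nilpotent_C1alpha_invariant_radon (α : ℝ≥0) (hα : 0 < α)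
    (G : Subgroup HomeoR) (hnilp : Group.IsNilpotent ↥G)
    (hsmooth : ∀ g ∈ G, ContDiff ℝ 1 (⇑g) ∧ (∀ x : ℝ, deriv (⇑g) x ≠ 0) ∧
      ∀ K : Set ℝ, IsCompact K → ∃ C : ℝ≥0, HolderOnWith C α (deriv (⇑g)) K) :
    ∃ μ : Measure ℝ, InvariantRadon G μ := by
  set ρ : G →* HomeoR := G.subtype
  suffices h : ∃ μ : Measure ℝ, μ ≠ 0 ∧ IsFiniteMeasureOnCompacts μ ∧
      ∀ g, Measure.map (ρ g) μ = μ by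
    obtain ⟨μ, h1, h2, h3⟩ := h
    exact ⟨μ, h1, h2, fun g hg => h3 ⟨g, hg⟩⟩
  by_cases hall : ∀ j, ∃ x, ∀ z ∈ Subgroup.upperCentralSeries G j, ρ z x = x
  · obtain ⟨n, hn⟩ := Group.IsNilpotent.nilpotent G
    obtain ⟨x, hx⟩ := hall n
    refine ⟨Measure.dirac x, IsProbabilityMeasure.ne_zero _, inferInstance, fun g => ?_⟩
    rw [Measure.map_dirac' (ρ g).continuous.measurable, hx g (hn ▸ Subgroup.mem_top g)]
  classical
  push Not at hall
  obtain ⟨i, hi, hmin⟩ : ∃ i, (∀ x, ∃ z ∈ Subgroup.upperCentralSeries G (i + 1), ρ z x ≠ x) ∧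
      ∃ x, ∀ z ∈ Subgroup.upperCentralSeries G i, ρ z x = x := by
    obtain ⟨i, hi⟩ : ∃ i, Nat.find hall = i + 1 := Nat.exists_eq_succ_of_ne_zero fun h0 => by
      have h1 := Nat.find_spec hall
      rw [h0] at h1
      obtain ⟨z, hz, hz'⟩ := h1 0
      rw [Subgroup.upperCentralSeries_zero, Subgroup.mem_bot] at hz
      exact hz' (by simp [hz])
    refine ⟨i, hi ▸ Nat.find_spec hall, ?_⟩
    have h2 := Nat.find_min hall (m := i) (by omega)
    push Not at h2
    exact h2
  obtain ⟨q, hq⟩ := hmin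
  set N := Subgroup.upperCentralSeries G i with hN
  set A := Subgroup.upperCentralSeries G (i + 1) with hA
  set F : Set ℝ := {x | ∀ z ∈ N, ρ z x = x} with hF
  have hFinv : ∀ g, ∀ x ∈ F, ρ g x ∈ F := by
    intro g x hx z hz
    have h1 : g⁻¹ * z * g ∈ N := by
      simpa using Subgroup.Normal.conj_mem inferInstance z hz g⁻¹
    have h2 := congrArg (ρ g) (hx _ h1)
    rwa [← RelIso.mul_apply, ← map_mul, mul_assoc g⁻¹, mul_inv_cancel_left, map_mul,
      RelIso.mul_apply] at h2
  have hcomm : ∀ g ∈ A, ∀ h, ∀ x ∈ F, ρ g (ρ h x) = ρ h (ρ g x) := by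
    intro g hg h x hx
    have h1 := Subgroup.mem_upperCentralSeries_succ_iff.1 hg h
    have h2 := hFinv h _ (hFinv g x hx) _ h1
    rwa [← RelIso.mul_apply, ← RelIso.mul_apply, ← map_mul, ← map_mul, commutatorElement_def,
      show g * h * g⁻¹ * h⁻¹ * h * g = g * h by group, map_mul, RelIso.mul_apply] at h2
  by_cases hfree : ∃ g ∈ A, ∀ x, ρ g x ≠ x
  · obtain ⟨g, hg, hgx, hgq⟩ : ∃ g ∈ A, (∀ x, ρ g x ≠ x) ∧ q < ρ g q := by
      obtain ⟨g, hg, hgx⟩ := hfree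
      rcases (hgx q).lt_or_gt with h | h
      · refine ⟨g⁻¹, inv_mem hg, fun x hx => hgx x ?_, ?_⟩
        · conv_lhs => rw [← hx]
          rw [map_inv, RelIso.apply_inv_self]
        · rwa [← (ρ g).lt_iff_lt, map_inv, RelIso.apply_inv_self]
      · exact ⟨g, hg, hgx, h⟩
    have hZ : ∀ h ∈ Subgroup.zpowers g, ∀ x ∈ range (fun m : ℤ => ρ (g ^ m) q),
        ρ h x ∈ range (fun m : ℤ => ρ (g ^ m) q) := by
      rintro _ ⟨n, rfl⟩ _ ⟨m, rfl⟩
      exact ⟨n + m, by simp [zpow_add]⟩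
    have hfix : ∀ x, ∃ h ∈ Subgroup.zpowers g, ρ h x ≠ x := fun x =>
      ⟨g, Subgroup.mem_zpowers g, hgx x⟩
    refine exists_invariantRadon_of_translation ρ q g hgq (fun x => ?_) (fun x => ?_) fun m h =>
      hcomm _ (zpow_mem hg m) h q hq
    · obtain ⟨_, ⟨m, rfl⟩, h⟩ := not_bddAbove_iff.1
        (not_bddAbove_of_no_fixed ρ _ hfix (range_nonempty _) hZ) x
      exact ⟨m, h⟩
    · obtain ⟨_, ⟨m, rfl⟩, h⟩ := not_bddBelow_iff.1
        (not_bddBelow_of_no_fixed ρ _ hfix (range_nonempty _) hZ) x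
      exact ⟨m, h⟩
  · exfalso
    push Not at hfree
    obtain ⟨c, hc, hc1⟩ : ∃ c ∈ Subgroup.upperCentralSeries G 1, c ≠ 1 := by
      by_contra! hcon
      have h1 : ∀ j, ∀ z ∈ Subgroup.upperCentralSeries G j, z = 1 := by
        intro j
        induction j with
        | zero => simp
        | succ j ih =>
          intro z hz
          refine hcon z (Subgroup.mem_upperCentralSeries_succ_iff.2 fun y => ?_)
          rw [ih _ (Subgroup.mem_upperCentralSeries_succ_iff.1 hz y)]
          exact one_mem _
      obtain ⟨z, hz, hz'⟩ := hi 0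
      exact hz' (by simp [h1 _ z hz])
    have hcc : ∀ g, Commute c g := by
      rw [Subgroup.upperCentralSeries_one] at hc
      exact fun g => (Subgroup.mem_center_iff.1 hc g).symm
    set K : Set ℝ := {x | x ∈ F ∧ ρ c x = x} with hK
    have hKinv : ∀ g, ∀ x ∈ K, ρ g x ∈ K := fun g x hx => ⟨hFinv g x hx.1, by
      rw [← RelIso.mul_apply, ← map_mul, (hcc g).eq, map_mul, RelIso.mul_apply, hx.2]⟩
    have hKne : K.Nonempty := by
      rcases Nat.eq_zero_or_pos i with h0 | h0
      · obtain ⟨x, hx⟩ := hfree c (by rw [hA, h0]; exact hc)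
        refine ⟨x, fun z hz => ?_, hx⟩
        rw [hN, h0, Subgroup.upperCentralSeries_zero, Subgroup.mem_bot] at hz
        simp [hz]
      · exact ⟨q, hq, hq c (Subgroup.upperCentralSeries_mono G h0 hc)⟩
    have hKclosed : IsClosed K := by
      have h1 : ∀ z : G, IsClosed {x | ρ z x = x} := fun z =>
        isClosed_eq (ρ z).continuous continuous_id
      have h2 : K = (⋂ z ∈ N, {x | ρ z x = x}) ∩ {x | ρ c x = x} := by
        ext x
        simp [hK, hF]
      rw [h2]
      exact (isClosed_biInter fun z _ => h1 z).inter (h1 c)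
    have habove : ∀ S : Set ℝ, S.Nonempty → (∀ h ∈ A, ∀ x ∈ S, ρ h x ∈ S) → ¬ BddAbove S :=
      fun S => not_bddAbove_of_no_fixed ρ A hi
    have hbelow : ∀ S : Set ℝ, S.Nonempty → (∀ h ∈ A, ∀ x ∈ S, ρ h x ∈ S) → ¬ BddBelow S :=
      fun S => not_bddBelow_of_no_fixed ρ A hi
    have hexp : ∀ x y : ℝ, ∃ g ∈ A.map ρ, ∃ x' ≤ x, ∃ y' ≥ y, y ≤ g x ∧ g x' = x' ∧ g y' = y' := by
      intro x y
      obtain ⟨_, ⟨⟨g, hg⟩, rfl⟩, hgy⟩ := not_bddAbove_iff.1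
        (habove (range fun g : A => ρ g x) (range_nonempty _) (by
          rintro h hh _ ⟨g, rfl⟩
          exact ⟨⟨h, hh⟩ * g, by simp⟩)) y
      obtain ⟨p, hp⟩ := hfree g hg
      obtain ⟨r, hr, hgr⟩ := exists_mem_fixed_of_fixed hKclosed
        (hbelow K hKne fun h _ => hKinv h) (hKinv g) (by simpa using hKinv g⁻¹) hp
      have hne : {z | z ∈ K ∧ ρ g z = z}.Nonempty := ⟨r, hr, hgr⟩
      have hS : ∀ h ∈ A, ∀ z ∈ {z | z ∈ K ∧ ρ g z = z}, ρ h z ∈ {z | z ∈ K ∧ ρ g z = z} :=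
        fun h _ z hz => ⟨hKinv h z hz.1, by rw [hcomm g hg h z hz.1.1, hz.2]⟩
      obtain ⟨x', hx', hxx'⟩ := not_bddBelow_iff.1 (hbelow _ hne hS) x
      obtain ⟨y', hy', hyy'⟩ := not_bddAbove_iff.1 (habove _ hne hS) y
      exact ⟨ρ g, Subgroup.mem_map_of_mem ρ hg, x', hxx'.le, y', hyy'.le, hgy.le, hx'.2, hy'.2⟩
    refine hc1 (Subtype.ext (OrderIso.ext (funext fun x => ?_)))
    obtain ⟨a, ha, hax⟩ := not_bddBelow_iff.1 (hbelow K hKne fun h _ => hKinv h) x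
    obtain ⟨b, hb, hxb⟩ := not_bddAbove_iff.1 (habove K hKne fun h _ => hKinv h) x
    refine apply_eq_of_central hα (A := A.map ρ) hsmooth ?_ (K := K) ?_ ?_ hexp ha hb c.2 ?_ ha.2
      hb.2 ⟨hax.le, hxb.le⟩
    · rintro _ ⟨g, _, rfl⟩
      exact g.2
    · rintro _ ⟨g, _, rfl⟩
      exact hKinv g
    · rintro _ ⟨g, hg, rfl⟩ _ ⟨h, _, rfl⟩ x hx
      exact hcomm g hg h x hx.1
    · rintro _ ⟨g, _, rfl⟩
      exact (hcc g).map ρ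
end

section
/- There exists a non-finitely-generated abelian subgroup G of the group of orientation-preserving C¹ diffeomorphisms of ℝ such that G admits no invariant Radon measure on ℝ and has no nonempty minimal closed invariant subset. -/
open Set MeasureTheory
open scoped NNReal

/-- Finitely supported integer sequences; the largest index at which two of them differ decides
which is larger. -/
abbrev Idx := Colex (ℕ →₀ ℤ)

namespace Idx

instance : Countable Idx := inferInstanceAs (Countable (ℕ →₀ ℤ))

/-- The `ℓ¹` norm. -/
noncomputable def size (γ : Idx) : ℝ := (ofColex γ).sum fun _ z => |(z : ℝ)|

lemma size_eq_sum (γ : Idx) {s : Finset ℕ} (hs : (ofColex γ).support ⊆ s) :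
    size γ = ∑ j ∈ s, |((ofColex γ j : ℤ) : ℝ)| :=
  Finsupp.sum_of_support_subset _ hs _ (by simp)

lemma size_nonneg (γ : Idx) : 0 ≤ size γ :=
  Finset.sum_nonneg fun _ _ => abs_nonneg _

lemma size_add_le (γ δ : Idx) : size (γ + δ) ≤ size γ + size δ := by
  classical
  set s := (ofColex γ).support ∪ (ofColex δ).support
  rw [size_eq_sum (γ + δ) (s := s) Finsupp.support_add,
    size_eq_sum γ (s := s) Finset.subset_union_left,
    size_eq_sum δ (s := s) Finset.subset_union_right, ← Finset.sum_add_distrib]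
  refine Finset.sum_le_sum fun j _ => ?_
  rw [ofColex_add, Finsupp.add_apply, Int.cast_add]
  exact abs_add_le _ _

lemma size_neg (γ : Idx) : size (-γ) = size γ := by
  rw [size_eq_sum (-γ) (s := (ofColex γ).support) (by simp [ofColex_neg]),
    size_eq_sum γ subset_rfl]
  simp [ofColex_neg]

lemma abs_apply_le_size (γ : Idx) (j : ℕ) : |((ofColex γ j : ℤ) : ℝ)| ≤ size γ := by
  classical
  rw [size_eq_sum γ (s := insert j (ofColex γ).support) (Finset.subset_insert _ _)]
  exact Finset.single_le_sum (f := fun j => |((ofColex γ j : ℤ) : ℝ)|)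
    (fun _ _ => abs_nonneg _) (Finset.mem_insert_self _ _)

lemma lt_iff {a b : Idx} :
    a < b ↔ ∃ i, (∀ j, i < j → ofColex a j = ofColex b j) ∧ ofColex a i < ofColex b i :=
  Finsupp.Colex.lt_iff

lemma apply_eq_zero_of_mem_Icc {a b γ : Idx} {k : ℕ} (ha : ∀ j, k ≤ j → ofColex a j = 0)
    (hb : ∀ j, k ≤ j → ofColex b j = 0) (hγ : γ ∈ Icc a b) : ∀ j, k ≤ j → ofColex γ j = 0 := by
  rcases hγ.1.eq_or_lt with rfl | h1
  · exact ha
  rcases hγ.2.eq_or_lt with rfl | h2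
  · exact hb
  obtain ⟨i, hi, hi'⟩ := lt_iff.1 h1
  obtain ⟨l, hl, hl'⟩ := lt_iff.1 h2
  intro j hj
  rcases lt_or_ge i j with h | h
  · rw [← hi j h, ha j hj]
  rcases lt_or_ge l j with h' | h'
  · rw [hl j h', hb j hj]
  rw [ha i (hj.trans h)] at hi'
  rw [hb l (hj.trans h')] at hl'
  rcases lt_trichotomy i l with h3 | h3 | h3
  · have := hi l h3
    rw [ha l (hj.trans h')] at this
    omega
  · subst h3; omega
  · have := hl i h3
    rw [hb i (hj.trans h)] at this
    omega

lemma exists_apply_eq_zero (a b : Idx) :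
    ∃ k, ∀ γ ∈ Icc a b, ∀ j, k ≤ j → ofColex γ j = 0 := by
  have key : ∀ c : Idx, ∃ k, ∀ j, k ≤ j → ofColex c j = 0 := fun c => by
    obtain ⟨k, hk⟩ := (ofColex c).support.bddAbove
    refine ⟨k + 1, fun j hj => ?_⟩
    by_contra h
    have := hk (Finset.mem_coe.2 (Finsupp.mem_support_iff.2 h))
    omega
  obtain ⟨k, hk⟩ := key a
  obtain ⟨l, hl⟩ := key b
  exact ⟨max k l, fun γ hγ => apply_eq_zero_of_mem_Icc
    (fun j hj => hk j (le_of_max_le_left hj)) (fun j hj => hl j (le_of_max_le_right hj)) hγ⟩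

lemma finite_Icc_size_le (a b : Idx) (M : ℝ) : {γ | γ ∈ Icc a b ∧ size γ ≤ M}.Finite := by
  classical
  obtain ⟨k, hk⟩ := exists_apply_eq_zero a b
  refine (((Finset.range k).finsupp fun _ => Finset.Icc (-⌈M⌉) ⌈M⌉).finite_toSet.image
    toColex).subset ?_
  rintro γ ⟨hγ, hM⟩
  refine ⟨ofColex γ, ?_, rfl⟩
  rw [Finset.mem_coe, Finset.mem_finsupp_iff]
  refine ⟨fun j hj => ?_, fun j _ => ?_⟩
  · by_contra h
    exact (Finsupp.mem_support_iff.1 hj) (hk γ hγ j (by simpa using h))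
  · have h1 := abs_le.1 ((abs_apply_le_size γ j).trans (hM.trans (Int.le_ceil M)))
    rw [Finset.mem_Icc]
    exact ⟨by exact_mod_cast h1.1, by exact_mod_cast h1.2⟩

lemma summable_fin_prod {w : ℤ → ℝ} (hw : Summable w) (h0 : ∀ z, 0 ≤ w z) (k : ℕ) :
    Summable fun v : Fin k → ℤ => ∏ j, w (v j) := by
  classical
  refine summable_of_sum_le (c := (∑' z, w z) ^ k)
    (fun v => Finset.prod_nonneg fun j _ => h0 _) fun s => ?_
  calc ∑ v ∈ s, ∏ j, w (v j)
      ≤ ∑ v ∈ Fintype.piFinset fun j => s.image fun v => v j, ∏ j, w (v j) := by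
        refine Finset.sum_le_sum_of_subset_of_nonneg (fun v hv => ?_)
          fun _ _ _ => Finset.prod_nonneg fun j _ => h0 _
        exact Fintype.mem_piFinset.2 fun j => Finset.mem_image_of_mem (fun v => v j) hv
    _ = ∏ j : Fin k, ∑ z ∈ s.image fun v => v j, w z :=
        by rw [Finset.prod_univ_sum]
    _ ≤ ∏ _j : Fin k, ∑' z, w z :=
        Finset.prod_le_prod (fun _ _ => Finset.sum_nonneg fun _ _ => h0 _)
          fun j _ => hw.sum_le_tsum _ fun _ _ => h0 _
    _ = (∑' z, w z) ^ k := by simp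

lemma summable_inv_sq : Summable fun z : ℤ => ((1 + |(z : ℝ)|)⁻¹) ^ 2 := by
  refine Summable.of_norm_bounded_eventually
    (Real.summable_abs_int_rpow (b := 2) (by norm_num)) ?_
  filter_upwards [(Set.finite_singleton (0 : ℤ)).compl_mem_cofinite] with z hz
  have hz' : 0 < |(z : ℝ)| := abs_pos.2 (by exact_mod_cast hz)
  rw [Real.norm_of_nonneg (by positivity), Real.rpow_neg hz'.le, Real.rpow_two, ← inv_pow]
  gcongr
  linarith

/-- Boxes have polynomial growth, so a large power of the size is summable over an interval. -/
lemma exists_tsum_Icc_lt_top (a b : Idx) :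
    ∃ m : ℕ, ∑' γ : Icc a b, ENNReal.ofReal ((1 + size γ)⁻¹ ^ m) < ⊤ := by
  classical
  obtain ⟨k, hk⟩ := exists_apply_eq_zero a b
  have hs := summable_fin_prod summable_inv_sq (fun z => by positivity) k
  let r : Icc a b → Fin k → ℤ := fun γ j => ofColex γ.1 j
  have hr : Function.Injective r := fun γ δ h => by
    refine Subtype.ext (ofColex.injective (Finsupp.ext fun j => ?_))
    rcases lt_or_ge j k with hj | hj
    · exact congrFun h ⟨j, hj⟩
    · rw [hk γ γ.2 j hj, hk δ δ.2 j hj]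
  refine ⟨2 * k, ?_⟩
  calc ∑' γ : Icc a b, ENNReal.ofReal ((1 + size γ)⁻¹ ^ (2 * k))
      ≤ ∑' γ : Icc a b, ENNReal.ofReal (∏ j, ((1 + |(r γ j : ℝ)|)⁻¹) ^ 2) := by
        refine ENNReal.tsum_le_tsum fun γ => ENNReal.ofReal_le_ofReal ?_
        rw [pow_mul, ← Fin.prod_const]
        have h0 := size_nonneg γ
        refine Finset.prod_le_prod (fun _ _ => by positivity) fun j _ => ?_
        have := abs_apply_le_size γ j
        gcongr
    _ ≤ ∑' v : Fin k → ℤ, ENNReal.ofReal (∏ j, ((1 + |(v j : ℝ)|)⁻¹) ^ 2) :=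
        ENNReal.tsum_comp_le_tsum_of_injective hr
          fun v => ENNReal.ofReal (∏ j, ((1 + |(v j : ℝ)|)⁻¹) ^ 2)
    _ < ⊤ := hs.tsum_ofReal_lt_top

/-- The basis vectors. -/
noncomputable def unit (k : ℕ) : Idx := toColex (Finsupp.single k 1)

lemma size_unit (k : ℕ) : size (unit k) = 1 := by
  rw [size_eq_sum (unit k) (s := {k}) Finsupp.support_single_subset]
  simp [unit]

lemma unit_pos (k : ℕ) : 0 < unit k := by
  refine lt_iff.2 ⟨k, fun j hj => ?_, ?_⟩
  · simp [unit, hj.ne]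
  · simp [unit]

lemma unit_lt_succ (k : ℕ) : unit k < unit (k + 1) := by
  refine lt_iff.2 ⟨k + 1, fun j hj => ?_, ?_⟩
  · have h1 : k ≠ j := by omega
    have h2 : k + 1 ≠ j := by omega
    simp [unit, h1, h2]
  · simp [unit]

lemma apply_nsmul (γ : Idx) (n j : ℕ) : ofColex (n • γ) j = n * ofColex γ j := by
  induction n with
  | zero => simp
  | succ n ih => rw [succ_nsmul, ofColex_add, Finsupp.add_apply, ih]; push_cast; ring

lemma nsmul_unit_lt (n k : ℕ) : n • unit k < unit (k + 1) := by
  refine lt_iff.2 ⟨k + 1, fun j hj => ?_, ?_⟩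
  · have h1 : k ≠ j := by omega
    have h2 : k + 1 ≠ j := by omega
    rw [apply_nsmul]
    simp [unit, h1, h2]
  · rw [apply_nsmul]
    simp [unit]

end Idx

instance : MeasurableSpace Idx := ⊤

instance : DiscreteMeasurableSpace Idx := ⟨fun _ => trivial⟩

/-- Lines indexed by `Idx`, laid out one after the other. -/
abbrev Pt := Idx ×ₗ ℝ

namespace Pt

instance : MeasurableSpace Pt := inferInstanceAs (MeasurableSpace (Idx × ℝ))

/-- The point with coordinate `t` on the line of index `γ`. -/
def mk (γ : Idx) (t : ℝ) : Pt := toLex (γ, t)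

/-- The index of the line through a point. -/
def idx (p : Pt) : Idx := (ofLex p).1

/-- The coordinate of a point on its line. -/
def coord (p : Pt) : ℝ := (ofLex p).2

@[simp] lemma idx_mk (γ : Idx) (t : ℝ) : (mk γ t).idx = γ := rfl

@[simp] lemma coord_mk (γ : Idx) (t : ℝ) : (mk γ t).coord = t := rfl

@[simp] lemma mk_idx_coord (p : Pt) : mk p.idx p.coord = p := rfl

lemma neg_mk (γ : Idx) (t : ℝ) : -mk γ t = mk (-γ) (-t) := rfl

@[simp] lemma idx_add (p q : Pt) : (p + q).idx = p.idx + q.idx := rfl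

@[simp] lemma coord_add (p q : Pt) : (p + q).coord = p.coord + q.coord := rfl

@[simp] lemma idx_neg (p : Pt) : (-p).idx = -p.idx := rfl

@[simp] lemma coord_neg (p : Pt) : (-p).coord = -p.coord := rfl

lemma lt_iff {p q : Pt} : p < q ↔ p.idx < q.idx ∨ p.idx = q.idx ∧ p.coord < q.coord :=
  Prod.Lex.lt_iff

lemma le_iff {p q : Pt} : p ≤ q ↔ p.idx < q.idx ∨ p.idx = q.idx ∧ p.coord ≤ q.coord :=
  Prod.Lex.le_iff

lemma mk_lt_mk {γ : Idx} {s t : ℝ} : mk γ s < mk γ t ↔ s < t := by simp [lt_iff]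

lemma mk_le_mk {γ : Idx} {s t : ℝ} : mk γ s ≤ mk γ t ↔ s ≤ t := by simp [le_iff]

lemma idx_mono : Monotone idx := fun p q h => by
  rcases le_iff.1 h with h | h
  exacts [h.le, h.1.le]

lemma measurable_mk (γ : Idx) : Measurable (mk γ) :=
  (measurable_const.prodMk measurable_id : Measurable fun t : ℝ => ((γ, t) : Idx × ℝ))

lemma measurable_of_lines {β : Type*} [MeasurableSpace β] {f : Pt → β}
    (h : ∀ γ, Measurable fun t => f (mk γ t)) : Measurable f :=
  (measurable_from_prod_countable_right h : Measurable (fun x : Idx × ℝ => f (toLex x)))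

lemma measurableSet_of_lines {S : Set Pt} (h : ∀ γ, MeasurableSet {t | mk γ t ∈ S}) :
    MeasurableSet S := by
  have : Measurable fun p => p ∈ S := measurable_of_lines fun γ => measurable_mem.2 (h γ)
  exact measurable_mem.1 this

lemma measurableSet_Ico (p q : Pt) : MeasurableSet (Ico p q) :=
  measurableSet_of_lines fun γ => by
    have : OrdConnected {t | mk γ t ∈ Ico p q} := ⟨fun s hs t ht u hu =>
      ⟨hs.1.trans (mk_le_mk.2 hu.1), (mk_le_mk.2 hu.2).trans_lt ht.2⟩⟩
    exact this.measurableSet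

/-- The sum of the Lebesgue measures of the lines. -/
noncomputable def base : Measure Pt := Measure.sum fun γ => volume.map (mk γ)

lemma lintegral_base {f : Pt → ENNReal} (hf : Measurable f) :
    ∫⁻ p, f p ∂base = ∑' γ, ∫⁻ t, f (mk γ t) := by
  rw [base, lintegral_sum_measure]
  exact tsum_congr fun γ => lintegral_map hf (measurable_mk γ)

lemma measurable_add_right (g : Pt) : Measurable fun p : Pt => p + g :=
  measurable_of_lines fun γ =>
    (measurable_mk (γ + g.idx)).comp (measurable_id.add_const g.coord)

lemma lintegral_base_add_right {f : Pt → ENNReal} (hf : Measurable f) (g : Pt) :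
    ∫⁻ p, f (p + g) ∂base = ∫⁻ p, f p ∂base := by
  rw [lintegral_base hf, lintegral_base (f := fun p => f (p + g)) (hf.comp (measurable_add_right g)),
    ← (Equiv.addRight g.idx).tsum_eq fun γ => ∫⁻ t, f (mk γ t)]
  refine tsum_congr fun γ => ?_
  exact lintegral_add_right_eq_self (fun t => f (mk (γ + g.idx) t)) g.coord

/-- The `ℓ¹` norm. -/
noncomputable def size (p : Pt) : ℝ := p.idx.size + |p.coord|

lemma size_nonneg (p : Pt) : 0 ≤ size p := add_nonneg p.idx.size_nonneg (abs_nonneg _)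

lemma size_add_le (p q : Pt) : size (p + q) ≤ size p + size q := by
  have h1 := Idx.size_add_le p.idx q.idx
  have h2 := abs_add_le p.coord q.coord
  simp only [size, idx_add, coord_add]
  linarith

lemma size_neg (p : Pt) : size (-p) = size p := by
  simp [size, Idx.size_neg]

lemma abs_size_add_sub_le (p g : Pt) : |size (p + g) - size p| ≤ size g := by
  have h1 := size_add_le p g
  have h2 := size_add_le (p + g) (-g)
  rw [size_neg, add_neg_cancel_right] at h2
  rw [abs_le]
  constructor <;> linarith

/-- A density which is integrable on intervals and varies slowly at infinity. -/
noncomputable def density (p : Pt) : ℝ := Real.exp (-√(1 + size p))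

lemma density_pos (p : Pt) : 0 < density p := Real.exp_pos _

lemma density_le_one (p : Pt) : density p ≤ 1 := by
  rw [density, Real.exp_le_one_iff]
  exact neg_nonpos.2 (Real.sqrt_nonneg _)

lemma continuous_density_mk (γ : Idx) : Continuous fun t => density (mk γ t) := by
  simp only [density, size, idx_mk, coord_mk]
  fun_prop

lemma measurable_density : Measurable density :=
  measurable_of_lines fun γ => (continuous_density_mk γ).measurable

lemma density_mk_le (m : ℕ) (γ : Idx) (t : ℝ) :
    density (mk γ t) ≤
      (2 * (m + 2)).factorial * ((1 + γ.size)⁻¹ ^ m * (1 + |t|)⁻¹ ^ 2) := by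
  have h0 := γ.size_nonneg
  set y : ℝ := 1 + (γ.size + |t|) with hy
  have hy0 : 0 < y := by positivity
  have h1 := Real.pow_div_factorial_le_exp (√y) (Real.sqrt_nonneg _) (2 * (m + 2))
  rw [pow_mul, Real.sq_sqrt hy0.le, div_le_iff₀ (by positivity)] at h1
  have h2 : (1 + γ.size) ^ m * (1 + |t|) ^ 2 ≤ y ^ (m + 2) := by
    rw [pow_add]
    have := abs_nonneg t
    gcongr <;> linarith
  have h3 : density (mk γ t) = (Real.exp (√y))⁻¹ := Real.exp_neg _
  rw [h3, inv_pow, inv_pow, ← mul_inv, ← div_eq_mul_inv, inv_eq_one_div,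
    div_le_div_iff₀ (Real.exp_pos _) (by positivity), one_mul]
  linarith

/-- The measure with the given density. -/
noncomputable def meas : Measure Pt := base.withDensity fun p => ENNReal.ofReal (density p)

lemma measurable_ofReal_density : Measurable fun p => ENNReal.ofReal (density p) :=
  measurable_density.ennreal_ofReal

lemma meas_apply {S : Set Pt} (hS : MeasurableSet S) :
    meas S = ∑' γ, ∫⁻ t in {t | mk γ t ∈ S}, ENNReal.ofReal (density (mk γ t)) := by
  rw [meas, withDensity_apply _ hS, ← lintegral_indicator hS,
    lintegral_base (measurable_ofReal_density.indicator hS)]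
  refine tsum_congr fun γ => ?_
  exact lintegral_indicator (measurable_mk γ hS) fun t => ENNReal.ofReal (density (mk γ t))

lemma meas_Ico_lt_top (p q : Pt) : meas (Ico p q) < ⊤ := by
  obtain ⟨m, hm⟩ := Idx.exists_tsum_Icc_lt_top p.idx q.idx
  have hI : ∫⁻ t : ℝ, ENNReal.ofReal ((1 + |t|)⁻¹ ^ 2) < ⊤ := by
    have h := (integrable_one_add_norm (E := ℝ) (μ := volume) (r := 2) (by simp)).lintegral_lt_top
    refine lt_of_eq_of_lt (lintegral_congr fun t => ?_) h
    rw [Real.rpow_neg (by positivity), Real.rpow_two, ← inv_pow, Real.norm_eq_abs]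
  rw [meas_apply (measurableSet_Ico p q)]
  calc ∑' γ, ∫⁻ t in {t | mk γ t ∈ Ico p q}, ENNReal.ofReal (density (mk γ t))
      ≤ ∑' γ, (Icc p.idx q.idx).indicator (fun γ => ENNReal.ofReal (2 * (m + 2)).factorial *
          (∫⁻ t : ℝ, ENNReal.ofReal ((1 + |t|)⁻¹ ^ 2)) *
            ENNReal.ofReal ((1 + γ.size)⁻¹ ^ m)) γ := by
        refine ENNReal.tsum_le_tsum fun γ => ?_
        by_cases hγ : γ ∈ Icc p.idx q.idx
        · rw [indicator_of_mem hγ]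
          have h0 := γ.size_nonneg
          calc ∫⁻ t in {t | mk γ t ∈ Ico p q}, ENNReal.ofReal (density (mk γ t))
              ≤ ∫⁻ t, ENNReal.ofReal (density (mk γ t)) := setLIntegral_le_lintegral _ _
            _ ≤ ∫⁻ t, ENNReal.ofReal (2 * (m + 2)).factorial *
                  ENNReal.ofReal ((1 + γ.size)⁻¹ ^ m) * ENNReal.ofReal ((1 + |t|)⁻¹ ^ 2) := by
                refine lintegral_mono fun t => ?_
                rw [mul_assoc, ← ENNReal.ofReal_mul (by positivity),
                  ← ENNReal.ofReal_mul (by positivity)]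
                exact ENNReal.ofReal_le_ofReal (density_mk_le m γ t)
            _ = _ := by
                rw [lintegral_const_mul _ (by fun_prop), mul_right_comm]
        · have : {t | mk γ t ∈ Ico p q} = ∅ := by
            ext t
            refine iff_of_false (fun h => hγ ?_) (notMem_empty t)
            exact ⟨idx_mono h.1, idx_mono h.2.le⟩
          rw [this, setLIntegral_empty]
          exact zero_le
    _ = ENNReal.ofReal (2 * (m + 2)).factorial * (∫⁻ t : ℝ, ENNReal.ofReal ((1 + |t|)⁻¹ ^ 2)) *
          ∑' γ : Icc p.idx q.idx, ENNReal.ofReal ((1 + γ.1.size)⁻¹ ^ m) := by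
        rw [← tsum_subtype, ENNReal.tsum_mul_left]
    _ < ⊤ := ENNReal.mul_lt_top (ENNReal.mul_lt_top ENNReal.ofReal_lt_top hI) hm

lemma meas_Ico_mk (γ : Idx) (s t : ℝ) :
    meas (Ico (mk γ s) (mk γ t)) = ∫⁻ u in Ico s t, ENNReal.ofReal (density (mk γ u)) := by
  rw [meas_apply (measurableSet_Ico _ _), tsum_eq_single γ]
  · simp only [mem_Ico, mk_le_mk, mk_lt_mk]
    rfl
  · intro δ hδ
    have : {u | mk δ u ∈ Ico (mk γ s) (mk γ t)} = ∅ := by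
      ext u
      refine iff_of_false (fun h => hδ ?_) (notMem_empty u)
      exact le_antisymm (idx_mono h.2.le) (idx_mono h.1)
    rw [this, setLIntegral_empty]

lemma meas_Ico_add (p q g : Pt) :
    meas (Ico (p + g) (q + g)) = ∫⁻ x in Ico p q, ENNReal.ofReal (density (x + g)) ∂base := by
  rw [meas, withDensity_apply _ (measurableSet_Ico _ _),
    ← lintegral_indicator (measurableSet_Ico _ _),
    ← lintegral_base_add_right (measurable_ofReal_density.indicator (measurableSet_Ico _ _)) g,
    ← lintegral_indicator (measurableSet_Ico _ _)]
  refine lintegral_congr fun x => ?_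
  simp only [indicator, mem_Ico, add_le_add_iff_right, add_lt_add_iff_right]

end Pt

namespace Pt

lemma toReal_meas_Ico_add {a b c : Pt} (hab : a ≤ b) (hbc : b ≤ c) :
    (meas (Ico a c)).toReal = (meas (Ico a b)).toReal + (meas (Ico b c)).toReal := by
  rw [← Ico_union_Ico_eq_Ico hab hbc,
    measure_union (Ico_disjoint_Ico_same) (measurableSet_Ico _ _),
    ENNReal.toReal_add (meas_Ico_lt_top _ _).ne (meas_Ico_lt_top _ _).ne]

/-- The position of a point of `Pt` on the real line: the signed measure of the points between
it and the origin. -/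
noncomputable def pos (p : Pt) : ℝ :=
  if 0 ≤ p then (meas (Ico 0 p)).toReal else -(meas (Ico p 0)).toReal

lemma pos_zero : pos 0 = 0 := by simp [pos]

lemma pos_sub_pos {p q : Pt} (h : p ≤ q) : pos q - pos p = (meas (Ico p q)).toReal := by
  unfold pos
  split_ifs with hq hp hp
  · linarith [toReal_meas_Ico_add hp h]
  · linarith [toReal_meas_Ico_add (not_le.1 hp).le hq]
  · exact absurd (hp.trans h) hq
  · linarith [toReal_meas_Ico_add h (not_le.1 hq).le]

lemma ofReal_pos_sub {p q : Pt} (h : p ≤ q) :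
    ENNReal.ofReal (pos q - pos p) = meas (Ico p q) := by
  rw [pos_sub_pos h, ENNReal.ofReal_toReal (meas_Ico_lt_top _ _).ne]

lemma pos_mono : Monotone pos := fun p q h => by
  have := pos_sub_pos h
  have := ENNReal.toReal_nonneg (a := meas (Ico p q))
  linarith

lemma pos_mk_lt_mk {γ : Idx} {s t : ℝ} (h : s < t) : pos (mk γ s) < pos (mk γ t) := by
  have h1 := ofReal_pos_sub (mk_le_mk (γ := γ).2 h.le)
  rw [meas_Ico_mk] at h1
  have : 0 < ∫⁻ u in Ico s t, ENNReal.ofReal (density (mk γ u)) := by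
    rw [setLIntegral_pos_iff (f := fun u => ENNReal.ofReal (density (mk γ u)))
      (measurable_ofReal_density.comp (measurable_mk γ))]
    have : Function.support (fun u => ENNReal.ofReal (density (mk γ u))) = univ := by
      ext u
      simp [density_pos]
    rw [this, univ_inter, Real.volume_Ico]
    exact ENNReal.ofReal_pos.2 (sub_pos.2 h)
  rw [← h1, ENNReal.ofReal_pos] at this
  linarith

lemma pos_strictMono : StrictMono pos := fun p q h => by
  have h1 : pos p < pos (mk p.idx (p.coord + 1)) := by
    conv_lhs => rw [← mk_idx_coord p]
    exact pos_mk_lt_mk (by linarith)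
  rcases lt_iff.1 h with h | h
  · exact h1.trans_le (pos_mono (le_iff.2 (Or.inl h)))
  · have := pos_mk_lt_mk (γ := p.idx) h.2
    rw [mk_idx_coord, h.1, mk_idx_coord] at this
    exact this

lemma pos_mk_sub_le {γ : Idx} {s t : ℝ} (h : s ≤ t) : pos (mk γ t) - pos (mk γ s) ≤ t - s := by
  have h1 := ofReal_pos_sub (mk_le_mk (γ := γ).2 h)
  rw [meas_Ico_mk] at h1
  rw [← ENNReal.ofReal_le_ofReal_iff (sub_nonneg.2 h), h1]
  calc ∫⁻ u in Ico s t, ENNReal.ofReal (density (mk γ u))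
      ≤ ∫⁻ u in Ico s t, 1 := lintegral_mono fun u => by
        simpa using density_le_one (mk γ u)
    _ = ENNReal.ofReal (t - s) := by simp

lemma le_pos_mk_sub {γ : Idx} {s t c : ℝ} (h : s ≤ t)
    (hc : ∀ u ∈ Ico s t, c ≤ density (mk γ u)) :
    c * (t - s) ≤ pos (mk γ t) - pos (mk γ s) := by
  have h0 : 0 ≤ pos (mk γ t) - pos (mk γ s) := sub_nonneg.2 (pos_mono (mk_le_mk.2 h))
  have h1 := ofReal_pos_sub (mk_le_mk (γ := γ).2 h)
  rw [meas_Ico_mk] at h1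
  rw [← ENNReal.ofReal_le_ofReal_iff h0, h1]
  calc ENNReal.ofReal (c * (t - s)) = ∫⁻ u in Ico s t, ENNReal.ofReal c := by
        simp [ENNReal.ofReal_mul' (sub_nonneg.2 h)]
    _ ≤ _ := setLIntegral_mono' _root_.measurableSet_Ico fun u hu => ENNReal.ofReal_le_ofReal (hc u hu)

lemma continuous_pos_mk (γ : Idx) : Continuous fun t => pos (mk γ t) := by
  refine (LipschitzWith.of_le_add fun s t => ?_).continuous
  rw [Real.dist_eq]
  rcases le_total t s with h | h
  · have := pos_mk_sub_le (γ := γ) h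
    rw [abs_of_nonneg (by linarith)]
    linarith
  · have := pos_mono (mk_le_mk (γ := γ).2 h)
    have := abs_nonneg (s - t)
    linarith

lemma measurable_pos : Measurable pos :=
  measurable_of_lines fun γ => (continuous_pos_mk γ).measurable

lemma isOpenEmbedding_pos_mk (γ : Idx) : Topology.IsOpenEmbedding fun t => pos (mk γ t) := by
  have hc := continuous_pos_mk γ
  have hm : StrictMono fun t => pos (mk γ t) := fun s t h => pos_mk_lt_mk h
  have ho : (range fun t => pos (mk γ t)).OrdConnected := (isPreconnected_range hc).ordConnected
  refine ⟨hm.isEmbedding_of_ordConnected ho, isOpen_iff_mem_nhds.2 ?_⟩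
  rintro _ ⟨t, rfl⟩
  exact Filter.mem_of_superset
    (Icc_mem_nhds (hm (show t - 1 < t by linarith)) (hm (show t < t + 1 by linarith)))
    (ho.out (mem_range_self _) (mem_range_self _))

/-- The `k`-th basis vector, as a point. -/
noncomputable def unit (k : ℕ) : Pt := mk (Idx.unit k) 0

lemma size_unit_le (k : ℕ) {s : ℝ} (hs : |s| ≤ 1) : size (mk (Idx.unit k) s) ≤ 2 := by
  simp only [size, idx_mk, coord_mk, Idx.size_unit]
  linarith

lemma unit_pos (k : ℕ) : 0 < unit k := lt_iff.2 (Or.inl (Idx.unit_pos k))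

lemma nsmul_unit_lt (n k : ℕ) : n • unit k < unit (k + 1) := by
  have : (n • unit k).idx = n • Idx.unit k := rfl
  exact lt_iff.2 (Or.inl (this ▸ Idx.nsmul_unit_lt n k))

lemma exp_le_density {p : Pt} (h : size p ≤ 2) : Real.exp (-√3) ≤ density p := by
  rw [density]
  gcongr
  linarith

lemma le_pos_unit (k : ℕ) : k * Real.exp (-√3) ≤ pos (unit k) := by
  induction k with
  | zero => simpa [pos_zero] using pos_mono (unit_pos 0).le
  | succ k ih =>
    have h1 := le_pos_mk_sub (γ := Idx.unit k) (zero_le_one' ℝ) fun u hu =>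
      exp_le_density (size_unit_le k (abs_le.2 ⟨by linarith [hu.1], hu.2.le⟩))
    have h2 : pos (mk (Idx.unit k) 1) ≤ pos (unit (k + 1)) :=
      pos_mono (le_iff.2 (Or.inl (Idx.unit_lt_succ k)))
    change _ ≤ _ - pos (unit k) at h1
    push_cast
    linarith

lemma pos_neg_unit_le (k : ℕ) : pos (-unit k) ≤ -(k * Real.exp (-√3)) := by
  induction k with
  | zero => simpa [pos_zero] using pos_mono (neg_nonpos.2 (unit_pos 0).le)
  | succ k ih =>
    have h1 := le_pos_mk_sub (γ := -Idx.unit k) (neg_nonpos.2 (zero_le_one' ℝ)) fun u hu =>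
      exp_le_density (p := mk (-Idx.unit k) u) (by
        rw [← size_neg, neg_mk, neg_neg]
        exact size_unit_le k (s := -u) (abs_le.2 ⟨by linarith [hu.2], by linarith [hu.1]⟩))
    have h2 : pos (-unit (k + 1)) ≤ pos (mk (-Idx.unit k) (-1)) :=
      pos_mono (le_iff.2 (Or.inl (neg_lt_neg (Idx.unit_lt_succ k))))
    have h3 : (-unit k : Pt) = mk (-Idx.unit k) 0 := by
      rw [unit, neg_mk, neg_zero]
    rw [← h3] at h1
    push_cast
    linarith

lemma exists_unit (R : ℝ) : ∃ k, pos (-unit k) < -R ∧ R < pos (unit k) := by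
  obtain ⟨k, hk⟩ := exists_nat_gt (R / Real.exp (-√3))
  rw [div_lt_iff₀ (Real.exp_pos _)] at hk
  exact ⟨k, (pos_neg_unit_le k).trans_lt (neg_lt_neg hk), hk.trans_le (le_pos_unit k)⟩

end Pt

namespace Pt

lemma exists_rat_of_mem {p : Pt} {V : Set ℝ} (hV : IsOpen V) (hp : pos p ∈ V) :
    (∃ r : ℚ, (r : ℝ) < p.coord ∧ pos (mk p.idx r) ∈ V) ∧
      ∃ r : ℚ, p.coord < r ∧ pos (mk p.idx r) ∈ V := by
  have h : (fun t => pos (mk p.idx t)) ⁻¹' V ∈ nhds p.coord :=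
    (hV.preimage (continuous_pos_mk p.idx)).mem_nhds hp
  obtain ⟨l, u, ⟨hl, hu⟩, hlu⟩ := mem_nhds_iff_exists_Ioo_subset.1 h
  obtain ⟨r, hr1, hr2⟩ := exists_rat_btwn hl
  obtain ⟨s, hs1, hs2⟩ := exists_rat_btwn hu
  exact ⟨⟨r, hr2, hlu ⟨hr1, hr2.trans hu⟩⟩, ⟨s, hs1, hlu ⟨hl.trans hs1, hs2⟩⟩⟩

lemma meas_preimage_Ioo_le (a b : ℝ) : meas (pos ⁻¹' Ioo a b) ≤ ENNReal.ofReal (b - a) := by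
  let e : Idx × ℚ → Pt := fun x => mk x.1 x.2
  let ι := {x : (Idx × ℚ) × (Idx × ℚ) // pos (e x.1) ∈ Ioo a b ∧ pos (e x.2) ∈ Ioo a b}
  let s : ι → Set Pt := fun x => Ico (e x.1.1) (e x.1.2)
  have hcover : pos ⁻¹' Ioo a b ⊆ ⋃ i, s i := fun p hp => by
    obtain ⟨⟨r, hr, hr'⟩, ⟨t, ht, ht'⟩⟩ := exists_rat_of_mem isOpen_Ioo hp
    exact mem_iUnion.2 ⟨⟨((p.idx, r), (p.idx, t)), hr', ht'⟩,
      (mk_lt_mk.2 hr).le, mk_lt_mk.2 ht⟩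
  have hdir : Directed (· ⊆ ·) s := by
    rintro ⟨⟨x, y⟩, hx, hy⟩ ⟨⟨z, w⟩, hz, hw⟩
    obtain ⟨l, hl, hlx, hlz⟩ : ∃ l, pos (e l) ∈ Ioo a b ∧ e l ≤ e x ∧ e l ≤ e z := by
      rcases le_total (e x) (e z) with h | h
      exacts [⟨x, hx, le_rfl, h⟩, ⟨z, hz, h, le_rfl⟩]
    obtain ⟨u, hu, huy, huw⟩ : ∃ u, pos (e u) ∈ Ioo a b ∧ e y ≤ e u ∧ e w ≤ e u := by
      rcases le_total (e y) (e w) with h | h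
      exacts [⟨w, hw, h, le_rfl⟩, ⟨y, hy, le_rfl, h⟩]
    exact ⟨⟨(l, u), hl, hu⟩, Ico_subset_Ico hlx huy, Ico_subset_Ico hlz huw⟩
  refine (measure_mono hcover).trans ?_
  rw [hdir.measure_iUnion]
  refine iSup_le fun x => ?_
  rcases le_total (e x.1.1) (e x.1.2) with h | h
  · rw [← ofReal_pos_sub h]
    exact ENNReal.ofReal_le_ofReal (by linarith [x.2.1.1, x.2.2.2])
  · simp [s, Ico_eq_empty_of_le h]

lemma map_pos_meas : meas.map pos = volume := by
  symm
  refine Real.measure_ext_Ioo_rat fun q r => ?_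
  generalize (q : ℝ) = a, (r : ℝ) = b
  rw [Measure.map_apply measurable_pos measurableSet_Ioo, Real.volume_Ioo]
  refine le_antisymm ?_ (meas_preimage_Ioo_le a b)
  rcases le_or_gt b a with hab | hab
  · simp [ENNReal.ofReal_of_nonpos (sub_nonpos.2 hab)]
  obtain ⟨k, hk1, hk2⟩ := exists_unit (max |a| |b|)
  have hfin : meas (pos ⁻¹' Ioo a b) ≠ ⊤ :=
    ((meas_preimage_Ioo_le a b).trans_lt ENNReal.ofReal_lt_top).ne
  refine ENNReal.ofReal_le_of_le_toReal (le_of_forall_pos_le_add fun ε hε => ?_)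
  set u := pos (-unit k)
  set v := pos (unit k)
  have hua : u < a := by linarith [neg_abs_le a, le_max_left |a| |b|]
  have hbv : b < v := by linarith [le_abs_self b, le_max_right |a| |b|]
  have hle : -unit k ≤ unit k := (neg_nonpos.2 (unit_pos k).le).trans (unit_pos k).le
  have hsub : Ico (-unit k) (unit k) ⊆ pos ⁻¹' Ioo (u - ε / 4) (a + ε / 4) ∪
      pos ⁻¹' Ioo a b ∪ pos ⁻¹' Ioo (b - ε / 4) (v + ε / 4) := fun p hp => by
    have h1 := pos_mono hp.1
    have h2 := pos_mono hp.2.le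
    simp only [mem_union, mem_preimage, mem_Ioo]
    rcases lt_or_ge (pos p) (a + ε / 4) with h | h
    · exact Or.inl (Or.inl ⟨by linarith, h⟩)
    rcases lt_or_ge (pos p) b with h' | h'
    · exact Or.inl (Or.inr ⟨by linarith, h'⟩)
    · exact Or.inr ⟨by linarith, by linarith⟩
  have key : ENNReal.ofReal (v - u) ≤ ENNReal.ofReal (a - u + ε / 2) +
      meas (pos ⁻¹' Ioo a b) + ENNReal.ofReal (v - b + ε / 2) := by
    rw [ofReal_pos_sub hle]
    refine (measure_mono hsub).trans ((measure_union_le _ _).trans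
      (add_le_add ((measure_union_le _ _).trans (add_le_add ?_ le_rfl)) ?_))
    · exact (meas_preimage_Ioo_le _ _).trans_eq (by ring_nf)
    · exact (meas_preimage_Ioo_le _ _).trans_eq (by ring_nf)
  rw [← ENNReal.ofReal_toReal hfin, ← ENNReal.ofReal_add (by linarith) ENNReal.toReal_nonneg,
    ← ENNReal.ofReal_add (add_nonneg (by linarith) ENNReal.toReal_nonneg) (by linarith),
    ENNReal.ofReal_le_ofReal_iff (add_nonneg (add_nonneg (by linarith) ENNReal.toReal_nonneg)
      (by linarith))] at key
  linarith

lemma denseRange_pos : DenseRange pos := by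
  refine dense_of_exists_between fun a b hab => ?_
  have h : 0 < meas (pos ⁻¹' Ioo a b) := by
    rw [← Measure.map_apply measurable_pos measurableSet_Ioo, map_pos_meas, Real.volume_Ioo]
    exact ENNReal.ofReal_pos.2 (sub_pos.2 hab)
  obtain ⟨p, hp⟩ := nonempty_of_measure_ne_zero h.ne'
  exact ⟨pos p, mem_range_self p, hp.1, hp.2⟩

/-- The derivative on the real line of the translation by `g`. -/
noncomputable def ratio (g : Pt) : ℝ → ℝ :=
  Function.extend pos (fun p => density (p + g) / density p) fun _ => 1

lemma ratio_pos_apply (g p : Pt) : ratio g (pos p) = density (p + g) / density p :=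
  pos_strictMono.injective.extend_apply _ _ _

lemma ratio_of_notMem {g : Pt} {x : ℝ} (hx : x ∉ range pos) : ratio g x = 1 :=
  Function.extend_apply' _ _ _ hx

lemma ratio_pos (g : Pt) (x : ℝ) : 0 < ratio g x := by
  by_cases hx : x ∈ range pos
  · obtain ⟨p, rfl⟩ := hx
    rw [ratio_pos_apply]
    exact div_pos (density_pos _) (density_pos _)
  · rw [ratio_of_notMem hx]
    exact one_pos

lemma abs_sqrt_sub_le (p g : Pt) : |√(1 + size p) - √(1 + size (p + g))| ≤
    size g / √(1 + size p) := by
  have hp := size_nonneg p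
  have hq := size_nonneg (p + g)
  have h1 : 0 < √(1 + size p) := Real.sqrt_pos.2 (by linarith)
  have h2 := Real.sqrt_nonneg (1 + size (p + g))
  rw [le_div_iff₀ h1]
  calc |√(1 + size p) - √(1 + size (p + g))| * √(1 + size p)
      ≤ |√(1 + size p) - √(1 + size (p + g))| * (√(1 + size p) + √(1 + size (p + g))) := by
        gcongr
        linarith
    _ = |size (p + g) - size p| := by
        rw [← abs_of_pos (show 0 < √(1 + size p) + √(1 + size (p + g)) by linarith), ← abs_mul,
          mul_comm, ← sq_sub_sq, Real.sq_sqrt (by linarith), Real.sq_sqrt (by linarith), abs_sub_comm]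
        ring_nf
    _ ≤ size g := abs_size_add_sub_le p g

lemma exists_abs_ratio_sub_one_lt (g : Pt) {ε : ℝ} (hε : 0 < ε) :
    ∃ M : ℝ, ∀ p, M < size p → |density (p + g) / density p - 1| < ε := by
  have h : Filter.Tendsto (fun x => Real.exp x) (nhds 0) (nhds 1) := by
    simpa using (Real.continuous_exp.tendsto 0)
  obtain ⟨η, hη, hη'⟩ := Metric.tendsto_nhds_nhds.1 h ε hε
  refine ⟨(size g / η) ^ 2, fun p hp => ?_⟩
  have hp0 := size_nonneg p
  have : density (p + g) / density p = Real.exp (√(1 + size p) - √(1 + size (p + g))) := by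
    rw [density, density, ← Real.exp_sub]
    ring_nf
  rw [this, ← Real.dist_eq]
  refine hη' ?_
  rw [Real.dist_eq, sub_zero]
  refine (abs_sqrt_sub_le p g).trans_lt ?_
  rw [div_lt_comm₀ (Real.sqrt_pos.2 (by linarith)) hη]
  exact Real.lt_sqrt_of_sq_lt (by linarith)

lemma continuous_ratio (g : Pt) : Continuous (ratio g) := by
  refine continuous_iff_continuousAt.2 fun x => ?_
  by_cases hx : x ∈ range pos
  · obtain ⟨p, rfl⟩ := hx
    rw [← mk_idx_coord p]
    refine (isOpenEmbedding_pos_mk p.idx).continuousAt_iff.1 (Continuous.continuousAt ?_)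
    have : ratio g ∘ (fun t => pos (mk p.idx t)) = fun t =>
        density (mk (p.idx + g.idx) (t + g.coord)) / density (mk p.idx t) :=
      funext fun t => ratio_pos_apply g _
    rw [this]
    exact ((continuous_density_mk _).comp (continuous_id.add_const _)).div
      (continuous_density_mk _) fun t => (density_pos _).ne'
  · rw [Metric.continuousAt_iff']
    intro ε hε
    rw [ratio_of_notMem hx]
    obtain ⟨M, hM⟩ := exists_abs_ratio_sub_one_lt g hε
    obtain ⟨k, hk1, hk2⟩ := exists_unit |x|
    have hfin := Idx.finite_Icc_size_le (-unit k).idx (unit k).idx M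
    set K : Set ℝ := ⋃ γ ∈ {γ | γ ∈ Icc (-unit k).idx (unit k).idx ∧ γ.size ≤ M},
      (fun t => pos (mk γ t)) '' Icc (-M) M
    have hK : IsClosed K := (hfin.isCompact_biUnion fun γ _ =>
      isCompact_Icc.image (continuous_pos_mk γ)).isClosed
    have hxK : x ∉ K := fun h => hx <| by
      obtain ⟨γ, -, t, -, ht⟩ := mem_iUnion₂.1 h
      exact ⟨_, ht⟩
    filter_upwards [hK.isOpen_compl.mem_nhds hxK,
      Ioo_mem_nhds (hk1.trans_le (neg_abs_le x)) ((le_abs_self x).trans_lt hk2)] with y hy hy'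
    by_cases hyr : y ∈ range pos
    · obtain ⟨p, rfl⟩ := hyr
      rw [ratio_pos_apply, Real.dist_eq]
      refine hM p (lt_of_not_ge fun hp => hy ?_)
      have h1 := p.idx.size_nonneg
      have h2 := abs_nonneg p.coord
      simp only [size] at hp
      exact mem_iUnion₂.2 ⟨p.idx, ⟨⟨idx_mono (pos_strictMono.lt_iff_lt.1 hy'.1).le,
        idx_mono (pos_strictMono.lt_iff_lt.1 hy'.2).le⟩, by linarith⟩,
        p.coord, abs_le.1 (by linarith), rfl⟩
    · simpa [ratio_of_notMem hyr] using hε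

end Pt

namespace Pt

lemma integral_ratio {p q : Pt} (h : p ≤ q) (g : Pt) :
    ∫ y in pos p..pos q, ratio g y = pos (q + g) - pos (p + g) := by
  have hpq := pos_mono h
  have hm : Measurable fun y => ENNReal.ofReal (ratio g y) :=
    (continuous_ratio g).measurable.ennreal_ofReal
  have hpre : pos ⁻¹' Ico (pos p) (pos q) = Ico p q := by
    ext x
    simp [pos_strictMono.le_iff_le, pos_strictMono.lt_iff_lt]
  have key : ∫⁻ y in Ico (pos p) (pos q), ENNReal.ofReal (ratio g y) =
      ENNReal.ofReal (pos (q + g) - pos (p + g)) := by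
    rw [ofReal_pos_sub (add_le_add_left h g), meas_Ico_add, ← map_pos_meas,
      setLIntegral_map _root_.measurableSet_Ico hm measurable_pos, hpre, meas,
      setLIntegral_withDensity_eq_setLIntegral_mul _ measurable_ofReal_density
        (g := fun x => ENNReal.ofReal (ratio g (pos x))) (hm.comp measurable_pos)
        (measurableSet_Ico p q)]
    refine lintegral_congr fun x => ?_
    simp only [Pi.mul_apply, ratio_pos_apply]
    rw [← ENNReal.ofReal_mul (density_pos x).le, mul_div_cancel₀ _ (density_pos x).ne']
  rw [intervalIntegral.integral_of_le hpq, ← integral_Ico_eq_integral_Ioc,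
    integral_eq_lintegral_of_nonneg_ae (Filter.Eventually.of_forall fun y => (ratio_pos g y).le)
      (continuous_ratio g).aestronglyMeasurable, key,
    ENNReal.toReal_ofReal (sub_nonneg.2 (pos_mono (add_le_add_left h g)))]

/-- The extension to the real line of the translation by `g`. -/
noncomputable def shift (g : Pt) (x : ℝ) : ℝ := pos g + ∫ y in 0..x, ratio g y

lemma shift_pos (g p : Pt) : shift g (pos p) = pos (p + g) := by
  rw [shift]
  rcases le_total 0 p with h | h
  · have := integral_ratio h g
    rw [pos_zero, zero_add] at this
    linarith
  · have := integral_ratio h g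
    rw [pos_zero, zero_add] at this
    rw [intervalIntegral.integral_symm]
    linarith

lemma hasDerivAt_shift (g : Pt) (x : ℝ) : HasDerivAt (shift g) (ratio g x) x :=
  ((continuous_ratio g).integral_hasStrictDerivAt 0 x).hasDerivAt.const_add _

lemma continuous_shift (g : Pt) : Continuous (shift g) :=
  continuous_iff_continuousAt.2 fun x => (hasDerivAt_shift g x).continuousAt

lemma deriv_shift (g : Pt) : deriv (shift g) = ratio g :=
  funext fun x => (hasDerivAt_shift g x).deriv

lemma contDiff_shift (g : Pt) : ContDiff ℝ 1 (shift g) :=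
  contDiff_one_iff_deriv.2
    ⟨fun x => (hasDerivAt_shift g x).differentiableAt, deriv_shift g ▸ continuous_ratio g⟩

lemma strictMono_shift (g : Pt) : StrictMono (shift g) :=
  strictMono_of_deriv_pos fun x => (congrFun (deriv_shift g) x).symm ▸ ratio_pos g x

lemma shift_add (g h : Pt) (x : ℝ) : shift (g + h) x = shift g (shift h x) := by
  refine congrFun (denseRange_pos.equalizer (continuous_shift _)
    ((continuous_shift g).comp (continuous_shift h)) (funext fun p => ?_)) x
  simp only [Function.comp_apply, shift_pos]
  rw [add_assoc, add_comm h g]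

lemma shift_zero (x : ℝ) : shift 0 x = x := by
  refine congrFun (denseRange_pos.equalizer (continuous_shift 0) continuous_id
    (funext fun p => ?_)) x
  simp [shift_pos]

/-- The translation by `g` as a homeomorphism of the real line. -/
noncomputable def shiftIso (g : Pt) : HomeoR :=
  (strictMono_shift g).orderIsoOfRightInverse (shift g) (shift (-g)) fun x => by
    rw [← shift_add, add_neg_cancel, shift_zero]

/-- The action of `Pt` on the real line. -/
noncomputable def shiftHom : Multiplicative Pt →* HomeoR where
  toFun g := shiftIso g.toAdd
  map_one' := by
    ext x
    exact shift_zero x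
  map_mul' g h := by
    ext x
    exact shift_add _ _ x

lemma shiftHom_injective : Function.Injective shiftHom := fun g h hgh => by
  have h1 : shift g.toAdd (pos 0) = shift h.toAdd (pos 0) := DFunLike.congr_fun hgh (pos 0)
  rw [shift_pos, shift_pos, zero_add, zero_add] at h1
  exact Multiplicative.toAdd.injective (pos_strictMono.injective h1)

/-- Arbitrarily large intervals are moved off themselves to the right, but with bounded
forward orbit, by some element of the group. -/
lemma exists_shift (R : ℝ) : ∃ g : Pt, ∃ a b M : ℝ, a < -R ∧ R < b ∧ shift g a = b ∧
    ∀ n : ℕ, shift (n • g) b ≤ M := by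
  obtain ⟨k, hk1, hk2⟩ := exists_unit R
  refine ⟨2 • unit k, pos (-unit k), pos (unit k), pos (unit (k + 1)), hk1, hk2, ?_,
    fun n => ?_⟩
  · rw [shift_pos, two_nsmul, neg_add_cancel_left]
  · rw [shift_pos]
    refine pos_mono (le_trans (le_of_eq ?_) (nsmul_unit_lt (2 * n + 1) k).le)
    rw [add_nsmul, one_nsmul, mul_comm 2 n, mul_nsmul', add_comm]

end Pt

/-- A finitely generated subgroup is countable. -/
lemma Subgroup.FG.countable {H : Type*} [Group H] {G : Subgroup H} (h : G.FG) :
    Countable G := by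
  obtain ⟨α, _, φ, hφ⟩ := Group.fg_iff_exists_freeGroup_hom_surjective_finite.1
    (Group.fg_iff_subgroup_fg G |>.2 h)
  classical
  have : Countable (FreeGroup α) := FreeGroup.toWord_injective.countable
  exact hφ.countable

namespace Pt

lemma not_fg_range_shiftHom : ¬ shiftHom.range.FG := fun h => by
  have := h.countable
  have hinj : Function.Injective fun t : ℝ => shiftHom.rangeRestrict (.ofAdd (mk 0 t)) :=
    fun s t hst => by
      have h1 := shiftHom_injective (congrArg Subtype.val hst)
      exact congrArg coord (Multiplicative.ofAdd.injective h1)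
  exact not_countable hinj.countable

lemma shift_nsmul_succ (g : Pt) (n : ℕ) (x : ℝ) :
    shift ((n + 1) • g) x = shift (n • g) (shift g x) := by
  rw [succ_nsmul, shift_add]

lemma shift_nsmul_succ' (g : Pt) (n : ℕ) (x : ℝ) :
    shift ((n + 1) • g) x = shift g (shift (n • g) x) := by
  rw [succ_nsmul', shift_add]

lemma monotone_shift_nsmul {g : Pt} {x : ℝ} (h : x ≤ shift g x) :
    Monotone fun n : ℕ => shift (n • g) x :=
  monotone_nat_of_le_succ fun n => by
    rw [shift_nsmul_succ]
    exact (strictMono_shift _).monotone h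

lemma measure_Ico_shift {μ : Measure ℝ} (hμ : ∀ f ∈ shiftHom.range, Measure.map (⇑f) μ = μ)
    (g : Pt) (a b : ℝ) : μ (Ico (shift g a) (shift g b)) = μ (Ico a b) := by
  conv_lhs => rw [← hμ _ ⟨.ofAdd g, rfl⟩]
  have hm : Measurable (shift g) := (continuous_shift g).measurable
  refine (Measure.map_apply hm _root_.measurableSet_Ico).trans (congrArg μ ?_)
  ext x
  simp [(strictMono_shift g).le_iff_le, (strictMono_shift g).lt_iff_lt]

lemma not_exists_invariantRadon : ¬ ∃ μ : Measure ℝ, InvariantRadon shiftHom.range μ := by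
  rintro ⟨μ, hμ0, hfin, hinv⟩
  refine hμ0 (Measure.measure_univ_eq_zero.1 ?_)
  have hU : (univ : Set ℝ) = ⋃ n : ℕ, Icc (-(n : ℝ)) n := by
    refine (eq_univ_of_forall fun x => mem_iUnion.2 ?_).symm
    obtain ⟨n, hn⟩ := exists_nat_ge |x|
    exact ⟨n, abs_le.1 hn⟩
  rw [hU]
  refine measure_iUnion_null fun R => ?_
  obtain ⟨g, a, b, M, ha, hb, hab, hM⟩ := exists_shift R
  have hR : (0 : ℝ) ≤ R := R.cast_nonneg
  have hle : a ≤ shift g a := by linarith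
  have hmono := monotone_shift_nsmul hle
  have hsucc : ∀ n : ℕ, shift (n • g) b = shift ((n + 1) • g) a := fun n => by
    rw [shift_nsmul_succ, hab]
  refine measure_mono_null (t := Ico a b)
    (fun x hx => ⟨ha.le.trans hx.1, hx.2.trans_lt hb⟩) ?_
  by_contra hne
  have hdisj : Pairwise (Function.onFun Disjoint
      fun n : ℕ => Ico (shift (n • g) a) (shift (n • g) b)) := by
    have := hmono.pairwise_disjoint_on_Ico_succ
    simpa only [hsucc, Nat.succ_eq_succ, Order.succ_eq_add_one] using this
  have hsub : ⋃ n : ℕ, Ico (shift (n • g) a) (shift (n • g) b) ⊆ Icc a M := by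
    refine iUnion_subset fun n x hx => ⟨?_, hx.2.le.trans (hM n)⟩
    have := hmono (Nat.zero_le n)
    simp only [zero_nsmul, shift_zero] at this
    exact this.trans hx.1
  have htop : μ (⋃ n : ℕ, Ico (shift (n • g) a) (shift (n • g) b)) = ⊤ := by
    rw [measure_iUnion hdisj fun _ => _root_.measurableSet_Ico]
    simp only [measure_Ico_shift hinv]
    exact ENNReal.tsum_const_eq_top_of_ne_zero hne
  exact (measure_mono hsub).not_gt (htop ▸ isCompact_Icc.measure_lt_top)

lemma not_exists_minimalSet : ¬ ∃ Λ : Set ℝ, MinimalSet shiftHom.range Λ := by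
  rintro ⟨Λ, ⟨x, hx⟩, hcl, hinv, hmin⟩
  have hmem : ∀ (g : Pt) {z : ℝ}, z ∈ Λ → shift g z ∈ Λ := fun g z hz =>
    hinv _ ⟨.ofAdd g, rfl⟩ ▸ mem_image_of_mem _ hz
  obtain ⟨g, a, b, M, ha, hb, hab, hM⟩ := exists_shift |x|
  have hax : a < x := ha.trans_le (neg_abs_le x)
  have hxb : x < b := (le_abs_self x).trans_lt hb
  have hxg : x < shift g x := hxb.trans (hab ▸ strictMono_shift g hax)
  have hmono := monotone_shift_nsmul hxg.le
  have hbdd : BddAbove (range fun n : ℕ => shift (n • g) x) := by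
    refine ⟨M, ?_⟩
    rintro _ ⟨n, rfl⟩
    exact ((strictMono_shift _).monotone hxb.le).trans (hM n)
  set y := ⨆ n : ℕ, shift (n • g) x
  have hy : Filter.Tendsto (fun n : ℕ => shift (n • g) x) Filter.atTop (nhds y) :=
    tendsto_atTop_ciSup hmono hbdd
  have hyΛ : y ∈ Λ := hcl.mem_of_tendsto hy (Filter.Eventually.of_forall fun n => hmem _ hx)
  have hyfix : shift g y = y := by
    refine tendsto_nhds_unique (((continuous_shift g).tendsto y).comp hy) ?_
    refine (hy.comp (Filter.tendsto_add_atTop_nat 1)).congr fun n => ?_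
    exact shift_nsmul_succ' g n x
  have hfix : ∀ (h : Pt) {z : ℝ}, shift g z = z → shift g (shift h z) = shift h z :=
    fun h z hz => by
      rw [← shift_add, add_comm, shift_add, hz]
  have heq := hmin (Λ ∩ {z | shift g z = z}) inter_subset_left ⟨y, hyΛ, hyfix⟩
    (hcl.inter (isClosed_eq (continuous_shift g) continuous_id)) ?_
  · exact hxg.ne' (heq.ge hx).2
  · rintro _ ⟨h, rfl⟩
    refine Subset.antisymm ?_ fun z hz => ?_
    · rintro _ ⟨z, hz, rfl⟩
      exact ⟨hmem h.toAdd hz.1, hfix h.toAdd hz.2⟩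
    · refine ⟨shift (-h.toAdd) z, ⟨hmem _ hz.1, hfix _ hz.2⟩, ?_⟩
      exact (shift_add _ _ z).symm.trans (by rw [add_neg_cancel, shift_zero])

end Pt

theorem C1_counterexample : ∃ G : Subgroup HomeoR,
    ¬ G.FG ∧
    (∀ f ∈ G, ∀ g ∈ G, f * g = g * f) ∧
    (∀ g ∈ G, ContDiff ℝ 1 (⇑g) ∧ ∀ x : ℝ, deriv (⇑g) x ≠ 0) ∧
    (¬ ∃ μ : Measure ℝ, InvariantRadon G μ) ∧
    (¬ ∃ Λ : Set ℝ, MinimalSet G Λ) := by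
  refine ⟨Pt.shiftHom.range, Pt.not_fg_range_shiftHom, ?_, ?_, Pt.not_exists_invariantRadon,
    Pt.not_exists_minimalSet⟩
  · rintro _ ⟨f, rfl⟩ _ ⟨g, rfl⟩
    rw [← map_mul, mul_comm, map_mul]
  · rintro _ ⟨g, rfl⟩
    refine ⟨Pt.contDiff_shift g.toAdd, fun x => ?_⟩
    exact (congrFun (Pt.deriv_shift g.toAdd) x).trans_ne (Pt.ratio_pos _ x).ne'
end
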